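/- Cauchy identity for q-Whittaker polynomials: for |q| < 1 and variables x = (x₁,…,x_n), y = (y₁,…,y_n) with |x_i y_j| < 1, ∑_{μ partition} b_μ(q) P_μ(x;q) P_μ(y;q) = ∏_{i,j=1}^{n} 1/(x_i y_j ; q)_∞, where b_μ(q) = ∏_{i≥1} 1/(q;q)_{μ_i − μ_{i+1}}. -/

import Mathlib

/-- Integer partitions, encoded as weakly decreasing eventually-zero sequences. -/
abbrev YD : Type := {f : ℕ → ℕ // (∀ i j : ℕ, i ≤ j → f j ≤ f i) ∧ ∃ N, f N = 0}

/-- The size of a partition. -/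
noncomputable def psize (f : ℕ → ℕ) : ℕ := ∑ᶠ i, f i

/-- `conj f c` is the length of the `(c+1)`-st column of the partition `f`. -/
noncomputable def conj (f : ℕ → ℕ) (c : ℕ) : ℕ := Nat.card {r : ℕ | c + 1 ≤ f r}

/-- The q-Pochhammer symbol `(p;p)_m`. -/
def qPoch (p : ℂ) (m : ℕ) : ℂ := ∏ j ∈ Finset.range m, (1 - p ^ (j + 1))

/-- The infinite q-Pochhammer symbol `(z;q)_∞ = ∏_{k ≥ 0} (1 - q^k z)`. -/
noncomputable def qPochInf (z q : ℂ) : ℂ := ∏' k : ℕ, (1 - q ^ k * z)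

/-! ### Vertically strict tableaux, the combinatorial R-matrix and the intrinsic energy.

A column of a vertically strict tableau is encoded as a `Finset ℕ` of its (distinct)
entries; a vertically strict tableau is the list of its columns, left to right. -/

/-- The sorted parenthesis word of the pair of columns `x ⊗ y`: letters written in
increasing order, entries of `x` marked `true` ("(" ) and entries of `y` marked
`false` (")"), with the convention that at equal letters the one of `x` comes first. -/
def colPairWord (n : ℕ) (x y : Finset ℕ) : List (ℕ × Bool) :=
  (List.range (n + 1)).flatMap fun l =>
    (if l ∈ x then [(l, true)] else []) ++ (if l ∈ y then [(l, false)] else [])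

/-- Match consecutive pairs "(" ")" in the word; return the list of unmatched "("
letters (most recent first) and unmatched ")" letters (in left-to-right order). -/
def scanRS (w : List (ℕ × Bool)) : List ℕ × List ℕ :=
  w.foldl
    (fun st p =>
      if p.2 then (p.1 :: st.1, st.2)
      else
        match st.1 with
        | [] => (st.1, st.2 ++ [p.1])
        | _ :: t => (t, st.2))
    ([], [])

/-- The local energy `H(x ⊗ y)`: the number of winding pairs, i.e. of pairs matched
cyclically among unmatched parentheses. -/
def Hloc (n : ℕ) (x y : Finset ℕ) : ℕ :=
  min (scanRS (colPairWord n x y)).1.length (scanRS (colPairWord n x y)).2.length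

/-- The right output component of the combinatorial R-matrix
`R(x ⊗ y) = ỹ ⊗ x̃`: this returns `x̃` (the column of the same height as `x`),
obtained by flipping the orientation of the parentheses left unmatched after the
winding matching. -/
def Rright (n : ℕ) (x y : Finset ℕ) : Finset ℕ :=
  let st := (scanRS (colPairWord n x y)).1
  let cl := (scanRS (colPairWord n x y)).2
  let h := min st.length cl.length
  (y \ (cl.drop h).toFinset) ∪ (st.drop h).toFinset

/-- `rowE n x ys = ∑_j H(x^{(j-1)} ⊗ y_j)` where `x` is carried to the right through
the columns `ys` by the combinatorial R-matrix. -/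
def rowE (n : ℕ) : Finset ℕ → List (Finset ℕ) → ℕ
  | _, [] => 0
  | x, y :: ys => Hloc n x y + rowE n (Rright n x y) ys

/-- The intrinsic energy `𝓗` of a vertically strict tableau given by its columns. -/
def intrinsicE (n : ℕ) : List (Finset ℕ) → ℕ
  | [] => 0
  | x :: ys => rowE n x ys + intrinsicE n ys

/-- The number of `a`-cells of a vertically strict tableau. -/
def cnt (L : List (Finset ℕ)) (a : ℕ) : ℕ := (L.map fun s => if a ∈ s then 1 else 0).sum

/-- Vertically strict tableaux of shape `μ` with entries in `{1,…,n}`: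
lists of columns, the `(j+1)`-st of which is a subset of `{1,…,n}` of size `μ'_{j+1}`. -/
abbrev VSTt (n : ℕ) (μ : ℕ → ℕ) : Type :=
  {L : List (Finset ℕ) // L.length = μ 0 ∧
    ∀ j : Fin L.length, (L.get j).card = conj μ (j : ℕ) ∧ ∀ a ∈ L.get j, 1 ≤ a ∧ a ≤ n}

/-- The q-Whittaker polynomial
`P_μ(x₁,…,x_n; q) = ∑_{V ∈ VST(μ)} q^{𝓗(V)} x^V`. -/
noncomputable def qWhit (n : ℕ) (x : ℕ → ℂ) (q : ℂ) (μ : ℕ → ℕ) : ℂ :=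
  ∑' V : VSTt n μ, q ^ intrinsicE n V.val * ∏ a ∈ Finset.Icc 1 n, x a ^ cnt V.val a

/-- `b_μ(q) = ∏_{i ≥ 1} 1/(q;q)_{μ_i - μ_{i+1}}`. -/
noncomputable def bmu (q : ℂ) (μ : ℕ → ℕ) : ℂ :=
  ∏ᶠ i : ℕ, (qPoch q (μ i - μ (i + 1)))⁻¹

/-- The running excess of letters of `u` over letters of `c`. -/
def excess (u c : Finset ℕ) (t : ℕ) : ℤ :=
  ((u.filter (· ≤ t)).card : ℤ) - ((c.filter (· ≤ t)).card : ℤ)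

lemma card_filter_le_succ (u : Finset ℕ) (t : ℕ) :
    (u.filter (· ≤ t + 1)).card = (u.filter (· ≤ t)).card + if t + 1 ∈ u then 1 else 0 := by
  have h : u.filter (· ≤ t + 1) = u.filter (· ≤ t) ∪ u.filter (· = t + 1) := by
    ext a; simp only [Finset.mem_filter, Finset.mem_union]; grind
  rw [h, Finset.card_union_of_disjoint]
  · congr 1
    rw [Finset.filter_eq']
    split_ifs <;> simp
  · rw [Finset.disjoint_left]
    intro a; simp only [Finset.mem_filter]; grind

lemma excess_succ (u c : Finset ℕ) (t : ℕ) :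
    excess u c (t + 1) = excess u c t + (if t + 1 ∈ u then 1 else 0)
      - (if t + 1 ∈ c then 1 else 0) := by
  simp only [excess, card_filter_le_succ]
  push_cast
  ring

lemma excess_zero {u c : Finset ℕ} (hu : 0 ∉ u) (hc : 0 ∉ c) : excess u c 0 = 0 := by
  have h (s : Finset ℕ) (hs : 0 ∉ s) : s.filter (· ≤ 0) = ∅ := by
    ext a; simp only [Finset.mem_filter, Finset.notMem_empty]; grind
  rw [excess, h u hu, h c hc, sub_self]

lemma colPairWord_succ (n : ℕ) (u c : Finset ℕ) :
    colPairWord (n + 1) u c = colPairWord n u c ++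
      ((if n + 1 ∈ u then [(n + 1, true)] else []) ++
        (if n + 1 ∈ c then [(n + 1, false)] else [])) := by
  rw [colPairWord, List.range_succ, List.flatMap_append]
  simp [colPairWord]

/-- One step of the bracket matching. -/
def scanStep (st : List ℕ × List ℕ) (p : ℕ × Bool) : List ℕ × List ℕ :=
  if p.2 then (p.1 :: st.1, st.2)
  else
    match st.1 with
    | [] => (st.1, st.2 ++ [p.1])
    | _ :: t => (t, st.2)

lemma scanRS_eq_foldl (w : List (ℕ × Bool)) : scanRS w = w.foldl scanStep ([], []) := rfl

lemma scanRS_append (w w' : List (ℕ × Bool)) :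
    scanRS (w ++ w') = w'.foldl scanStep (scanRS w) := by
  simp only [scanRS_eq_foldl, List.foldl_append]

lemma scanRS_colPairWord {u c : Finset ℕ} (hu : 0 ∉ u) (hc : 0 ∉ c) (t : ℕ) :
    let p := scanRS (colPairWord t u c)
    (p.1.length : ℤ) = excess u c t + p.2.length ∧
    (∀ s ≤ t, -excess u c s ≤ p.2.length) ∧ (∃ s ≤ t, (p.2.length : ℤ) = -excess u c s) ∧
    ∀ k a, a ∈ p.1.drop k ↔ a ≤ t ∧ a ∈ u ∧ a ∉ c ∧
      (∀ b, a < b → b ≤ t → excess u c a ≤ excess u c b) ∧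
      ∀ s ≤ a, excess u c a - excess u c s ≤ (p.1.length : ℤ) - k := by
  induction t with
  | zero =>
    have h : colPairWord 0 u c = [] := by simp [colPairWord, hu, hc]
    simp only [h, scanRS, List.foldl_nil]
    refine ⟨by simp [excess_zero hu hc], ?_, ⟨0, le_rfl, by simp [excess_zero hu hc]⟩, ?_⟩
    · intro s hs; obtain rfl : s = 0 := by omega
      simp [excess_zero hu hc]
    · intro k a
      simp only [List.drop_nil, List.not_mem_nil, false_iff]
      rintro ⟨h0, h1, -⟩
      obtain rfl : a = 0 := by omega
      exact hu h1
  | succ t ih =>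
    rw [colPairWord_succ, scanRS_append]
    generalize scanRS (colPairWord t u c) = p at ih ⊢
    obtain ⟨st, cl⟩ := p
    obtain ⟨h1, h2, ⟨s0, hs0, h3⟩, h4⟩ := ih
    simp only at h1 h2 h3 h4
    have hD := excess_succ u c t
    have hle : ∀ s, s ≤ t + 1 ↔ s ≤ t ∨ s = t + 1 := by intro s; omega
    have hst0 : ∀ a, a ≤ t → (∀ b, a < b → b ≤ t → excess u c a ≤ excess u c b) →
        excess u c a ≤ excess u c t := by
      intro a ha hb
      rcases ha.lt_or_eq with h | rfl
      · exact hb t h le_rfl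
      · exact le_rfl
    by_cases hlu : t + 1 ∈ u <;> by_cases hlc : t + 1 ∈ c
    · simp only [hlu, hlc, if_true] at hD
      simp only [hlu, hlc, if_true, List.cons_append, List.nil_append, List.foldl_cons,
        List.foldl_nil, scanStep, Bool.false_eq_true, if_false]
      refine ⟨by omega, ?_, ⟨s0, by omega, h3⟩, ?_⟩
      · intro s hs
        rcases (hle s).1 hs with h | rfl
        · exact h2 s h
        · have := h2 t le_rfl; omega
      · intro k a
        rw [h4]
        constructor
        · rintro ⟨a1, a2, a3, a4, a5⟩
          refine ⟨by omega, a2, a3, ?_, a5⟩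
          intro b hb hb'
          rcases (hle b).1 hb' with h | rfl
          · exact a4 b hb h
          · have := hst0 a a1 a4; omega
        · rintro ⟨a1, a2, a3, a4, a5⟩
          rcases (hle a).1 a1 with h | rfl
          · exact ⟨h, a2, a3, fun b hb hb' => a4 b hb (by omega), a5⟩
          · exact absurd hlc a3
    · simp only [hlu, hlc, if_true, if_false] at hD
      simp only [hlu, hlc, if_true, List.append_nil, List.foldl_cons,
        List.foldl_nil, scanStep, if_false, List.length_cons]
      refine ⟨by push_cast; omega, ?_, ⟨s0, by omega, h3⟩, ?_⟩
      · intro s hs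
        rcases (hle s).1 hs with h | rfl
        · exact h2 s h
        · have := h2 t le_rfl; omega
      · intro k a
        constructor
        · intro ha
          have hcase : (a = t + 1 ∧ k = 0) ∨ a ∈ st.drop (k - 1) := by
            rcases k with _ | k
            · rw [List.drop_zero, List.mem_cons] at ha
              simpa using ha
            · right; simpa using ha
          rcases hcase with ⟨rfl, rfl⟩ | ha
          · refine ⟨le_rfl, hlu, hlc, by omega, ?_⟩
            intro s hs
            rcases (hle s).1 hs with h | rfl
            · have := h2 s h; push_cast; omega
            · push_cast; omega
          · obtain ⟨a1, a2, a3, a4, a5⟩ := (h4 _ _).1 ha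
            refine ⟨by omega, a2, a3, ?_, ?_⟩
            · intro b hb hb'
              rcases (hle b).1 hb' with h | rfl
              · exact a4 b hb h
              · have := hst0 a a1 a4; omega
            · intro s hs; have := a5 s hs; push_cast; omega
        · rintro ⟨a1, a2, a3, a4, a5⟩
          rcases (hle a).1 a1 with h | rfl
          · have a4' : ∀ b, a < b → b ≤ t → excess u c a ≤ excess u c b :=
              fun b hb hb' => a4 b hb (by omega)
            rcases k with _ | k
            · rw [List.drop_zero, List.mem_cons]
              right
              rw [← List.drop_zero (l := st), h4]
              refine ⟨h, a2, a3, a4', ?_⟩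
              intro s hs
              have := h2 s (by omega)
              have := hst0 a h a4'
              push_cast; omega
            · rw [List.drop_succ_cons, h4]
              refine ⟨h, a2, a3, a4', ?_⟩
              intro s hs
              have := a5 s hs
              push_cast at this ⊢; omega
          · rcases k with _ | k
            · simp
            · have := a5 s0 (by omega)
              push_cast at this; omega
    · simp only [hlu, hlc, if_true, if_false] at hD
      simp only [hlu, hlc, if_true, List.nil_append, List.foldl_cons,
        List.foldl_nil, scanStep, Bool.false_eq_true, if_false]
      rcases st with _ | ⟨x, tl⟩
      · simp only [List.length_nil, List.length_append, List.length_singleton,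
          List.drop_nil, List.not_mem_nil] at *
        refine ⟨by push_cast at *; omega, ?_, ⟨t + 1, le_rfl, by push_cast at *; omega⟩, ?_⟩
        · intro s hs
          rcases (hle s).1 hs with h | rfl
          · have := h2 s h; push_cast; omega
          · push_cast at *; omega
        · intro k a
          simp only [false_iff]
          rintro ⟨a1, a2, a3, a4, a5⟩
          rcases (hle a).1 a1 with h | rfl
          · have := a4 (t + 1) (by omega) le_rfl
            have := h2 a h
            push_cast at *; omega
          · exact hlu a2
      · simp only [List.length_cons] at *
        refine ⟨by push_cast at *; omega, ?_, ⟨s0, by omega, h3⟩, ?_⟩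
        · intro s hs
          rcases (hle s).1 hs with h | rfl
          · exact h2 s h
          · push_cast at *; omega
        · intro k a
          have h5 := h4 (k + 1) a
          rw [List.drop_succ_cons] at h5
          rw [h5]
          constructor
          · rintro ⟨a1, a2, a3, a4, a5⟩
            refine ⟨by omega, a2, a3, ?_, ?_⟩
            · intro b hb hb'
              rcases (hle b).1 hb' with h | rfl
              · exact a4 b hb h
              · by_cases hsa : s0 ≤ a
                · have := a5 s0 hsa; push_cast at *; omega
                · have := a4 s0 (by omega) hs0
                  have := a5 a le_rfl
                  push_cast at *; omega
            · intro s hs; have := a5 s hs; push_cast at *; omega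
          · rintro ⟨a1, a2, a3, a4, a5⟩
            rcases (hle a).1 a1 with h | rfl
            · refine ⟨h, a2, a3, fun b hb hb' => a4 b hb (by omega), ?_⟩
              intro s hs; have := a5 s hs; push_cast at *; omega
            · exact absurd a2 hlu
    · simp only [hlu, hlc, if_false] at hD
      simp only [hlu, hlc, List.append_nil, List.foldl_nil, if_false]
      refine ⟨by omega, ?_, ⟨s0, by omega, h3⟩, ?_⟩
      · intro s hs
        rcases (hle s).1 hs with h | rfl
        · exact h2 s h
        · have := h2 t le_rfl; omega
      · intro k a
        rw [h4]
        constructor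
        · rintro ⟨a1, a2, a3, a4, a5⟩
          refine ⟨by omega, a2, a3, ?_, a5⟩
          intro b hb hb'
          rcases (hle b).1 hb' with h | rfl
          · exact a4 b hb h
          · have := hst0 a a1 a4; omega
        · rintro ⟨a1, a2, a3, a4, a5⟩
          rcases (hle a).1 a1 with h | rfl
          · exact ⟨h, a2, a3, fun b hb hb' => a4 b hb (by omega), a5⟩
          · exact absurd a2 hlu

lemma excess_top {n : ℕ} {u c : Finset ℕ} (hu : u ⊆ Finset.Icc 1 n) (hc : c ⊆ Finset.Icc 1 n) :
    excess u c n = (u.card : ℤ) - c.card := by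
  have h (s : Finset ℕ) (hs : s ⊆ Finset.Icc 1 n) : s.filter (· ≤ n) = s :=
    Finset.filter_true_of_mem fun a ha => (Finset.mem_Icc.1 (hs ha)).2
  rw [excess, h u hu, h c hc]

lemma zero_notMem_of_subset {n : ℕ} {u : Finset ℕ} (hu : u ⊆ Finset.Icc 1 n) : 0 ∉ u :=
  fun h => absurd (Finset.mem_Icc.1 (hu h)).1 (by norm_num)

/-- The letter `a` survives as an unmatched, non-winding opening bracket. -/
def Kept (n : ℕ) (u c : Finset ℕ) (a : ℕ) : Prop :=
  (∀ b, a < b → b ≤ n → excess u c a ≤ excess u c b) ∧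
    ∀ s ≤ a, excess u c a - excess u c s ≤ excess u c n

lemma Hloc_spec {n : ℕ} {u c : Finset ℕ} (hu : u ⊆ Finset.Icc 1 n) (hc : c ⊆ Finset.Icc 1 n)
    (h : c.card ≤ u.card) :
    (∀ s ≤ n, -excess u c s ≤ Hloc n u c) ∧ ∃ s ≤ n, (Hloc n u c : ℤ) = -excess u c s := by
  obtain ⟨h1, h2, h3, -⟩ :=
    scanRS_colPairWord (zero_notMem_of_subset hu) (zero_notMem_of_subset hc) n
  have ht := excess_top hu hc
  have : Hloc n u c = (scanRS (colPairWord n u c)).2.length := by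
    rw [Hloc]; omega
  rw [this]
  exact ⟨h2, h3⟩

lemma mem_Rright {n : ℕ} {u c : Finset ℕ} (hu : u ⊆ Finset.Icc 1 n) (hc : c ⊆ Finset.Icc 1 n)
    (h : c.card ≤ u.card) (a : ℕ) :
    a ∈ Rright n u c ↔ a ∈ c ∨ (a ∈ u ∧ Kept n u c a) := by
  obtain ⟨h1, h2, h3, h4⟩ :=
    scanRS_colPairWord (zero_notMem_of_subset hu) (zero_notMem_of_subset hc) n
  have ht := excess_top hu hc
  have hmin : min (scanRS (colPairWord n u c)).1.length (scanRS (colPairWord n u c)).2.length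
      = (scanRS (colPairWord n u c)).2.length := by omega
  simp only [Rright, hmin, List.drop_length, List.toFinset_nil, Finset.sdiff_empty,
    Finset.mem_union, List.mem_toFinset, h4, Kept]
  have hlen : ((scanRS (colPairWord n u c)).1.length : ℤ) - (scanRS (colPairWord n u c)).2.length
      = excess u c n := by omega
  rw [hlen]
  by_cases hac : a ∈ c
  · simp [hac]
  · simp only [hac, false_or, not_false_eq_true, true_and]
    constructor
    · rintro ⟨_, b, c⟩; exact ⟨b, c⟩
    · rintro ⟨b, c⟩; exact ⟨(Finset.mem_Icc.1 (hu b)).2, b, c⟩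

lemma scanRS_nodup {u c : Finset ℕ} (hu : 0 ∉ u) (hc : 0 ∉ c) (t : ℕ) :
    (scanRS (colPairWord t u c)).1.Nodup := by
  induction t with
  | zero =>
    have h : colPairWord 0 u c = [] := by simp [colPairWord, hu, hc]
    simp [h, scanRS]
  | succ t ih =>
    have hm : t + 1 ∉ (scanRS (colPairWord t u c)).1 := by
      intro h
      rw [← List.drop_zero (l := (scanRS (colPairWord t u c)).1),
        (scanRS_colPairWord hu hc t).2.2.2] at h
      omega
    rw [colPairWord_succ, scanRS_append]
    generalize scanRS (colPairWord t u c) = p at ih hm ⊢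
    obtain ⟨st, cl⟩ := p
    rcases st with _ | ⟨x, tl⟩ <;> split_ifs <;> simp_all [scanStep]

lemma card_Rright {n : ℕ} {u c : Finset ℕ} (hu : u ⊆ Finset.Icc 1 n) (hc : c ⊆ Finset.Icc 1 n)
    (h : c.card ≤ u.card) : (Rright n u c).card = u.card := by
  obtain ⟨h1, h2, h3, h4⟩ :=
    scanRS_colPairWord (zero_notMem_of_subset hu) (zero_notMem_of_subset hc) n
  have ht := excess_top hu hc
  have hmin : min (scanRS (colPairWord n u c)).1.length (scanRS (colPairWord n u c)).2.length
      = (scanRS (colPairWord n u c)).2.length := by omega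
  simp only [Rright, hmin, List.drop_length, List.toFinset_nil, Finset.sdiff_empty]
  rw [Finset.card_union_of_disjoint, List.toFinset_card_of_nodup, List.length_drop]
  · omega
  · exact (scanRS_nodup (zero_notMem_of_subset hu) (zero_notMem_of_subset hc) n).sublist
      (List.drop_sublist _ _)
  · rw [Finset.disjoint_left]
    intro a ha hb
    rw [List.mem_toFinset, h4] at hb
    exact hb.2.2.1 ha

lemma Rright_subset {n : ℕ} {u c : Finset ℕ} (hu : u ⊆ Finset.Icc 1 n)
    (hc : c ⊆ Finset.Icc 1 n) (h : c.card ≤ u.card) : Rright n u c ⊆ Finset.Icc 1 n := by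
  intro a ha
  rcases (mem_Rright hu hc h a).1 ha with h | h
  · exact hc h
  · exact hu h.1

/-- A permutation acting on a column. -/
def colAct (σ : Equiv.Perm ℕ) (u : Finset ℕ) : Finset ℕ := u.map σ.toEmbedding

lemma mem_colAct (σ : Equiv.Perm ℕ) (u : Finset ℕ) (a : ℕ) : a ∈ colAct σ u ↔ σ.symm a ∈ u :=
  Finset.mem_map_equiv

lemma card_colAct (σ : Equiv.Perm ℕ) (u : Finset ℕ) : (colAct σ u).card = u.card :=
  Finset.card_map _

lemma mem_colAct_swap_left (i : ℕ) (u : Finset ℕ) :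
    i ∈ colAct (Equiv.swap i (i + 1)) u ↔ i + 1 ∈ u := by
  rw [mem_colAct, Equiv.symm_swap, Equiv.swap_apply_left]

lemma mem_colAct_swap_right (i : ℕ) (u : Finset ℕ) :
    i + 1 ∈ colAct (Equiv.swap i (i + 1)) u ↔ i ∈ u := by
  rw [mem_colAct, Equiv.symm_swap, Equiv.swap_apply_right]

lemma mem_colAct_swap_of_ne {i a : ℕ} (h1 : a ≠ i) (h2 : a ≠ i + 1) (u : Finset ℕ) :
    a ∈ colAct (Equiv.swap i (i + 1)) u ↔ a ∈ u := by
  rw [mem_colAct, Equiv.symm_swap, Equiv.swap_apply_of_ne_of_ne h1 h2]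

lemma colAct_swap_subset {n i : ℕ} (hi : 1 ≤ i) (hin : i < n) {u : Finset ℕ}
    (hu : u ⊆ Finset.Icc 1 n) : colAct (Equiv.swap i (i + 1)) u ⊆ Finset.Icc 1 n := by
  intro a ha
  by_cases h1 : a = i
  · rw [Finset.mem_Icc]; omega
  by_cases h2 : a = i + 1
  · rw [Finset.mem_Icc]; omega
  exact hu ((mem_colAct_swap_of_ne h1 h2 u).1 ha)

lemma colAct_swap_self (i : ℕ) (u : Finset ℕ) (h : i ∈ u ↔ i + 1 ∈ u) :
    colAct (Equiv.swap i (i + 1)) u = u := by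
  ext a
  by_cases h1 : a = i
  · subst h1; rw [mem_colAct_swap_left]; exact h.symm
  by_cases h2 : a = i + 1
  · subst h2; rw [mem_colAct_swap_right]; exact h
  exact mem_colAct_swap_of_ne h1 h2 u

lemma colAct_swap_swap (i : ℕ) (u : Finset ℕ) :
    colAct (Equiv.swap i (i + 1)) (colAct (Equiv.swap i (i + 1)) u) = u := by
  ext a
  rw [mem_colAct, mem_colAct, Equiv.symm_swap, Equiv.swap_apply_self]

/-- Two pairs of columns whose excess functions differ only at `i`, where neither has a strict
local minimum. -/
structure ExcessSim (n i : ℕ) (u c u' c' : Finset ℕ) : Prop where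
  eq_of_ne : ∀ t, t ≠ i → excess u' c' t = excess u c t
  le_left : min (excess u c (i - 1)) (excess u c (i + 1)) ≤ excess u c i
  le_right : min (excess u c (i - 1)) (excess u c (i + 1)) ≤ excess u' c' i

lemma ExcessSim.of_mem {n i : ℕ} {u c u' c' : Finset ℕ} (hi : 1 ≤ i)
    (hu : u ⊆ Finset.Icc 1 n) (hc : c ⊆ Finset.Icc 1 n)
    (hu' : u' ⊆ Finset.Icc 1 n) (hc' : c' ⊆ Finset.Icc 1 n)
    (hne : ∀ a, a ≠ i → a ≠ i + 1 → ((a ∈ u' ↔ a ∈ u) ∧ (a ∈ c' ↔ a ∈ c)))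
    (hsum : ((if i ∈ u then 1 else 0) + (if i + 1 ∈ u then 1 else 0)
        - (if i ∈ c then 1 else 0) - (if i + 1 ∈ c then 1 else 0) : ℤ)
      = (if i ∈ u' then 1 else 0) + (if i + 1 ∈ u' then 1 else 0)
        - (if i ∈ c' then 1 else 0) - (if i + 1 ∈ c' then 1 else 0))
    (h1 : ¬ (i ∉ u ∧ i + 1 ∈ u ∧ i ∈ c ∧ i + 1 ∉ c))
    (h2 : ¬ (i ∉ u' ∧ i + 1 ∈ u' ∧ i ∈ c' ∧ i + 1 ∉ c')) : ExcessSim n i u c u' c' := by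
  have hlt : ∀ t, t < i → excess u' c' t = excess u c t := by
    intro t
    induction t with
    | zero =>
      intro _
      rw [excess_zero (zero_notMem_of_subset hu) (zero_notMem_of_subset hc),
        excess_zero (zero_notMem_of_subset hu') (zero_notMem_of_subset hc')]
    | succ t ih =>
      intro ht
      have := hne (t + 1) (by omega) (by omega)
      simp only [excess_succ, ih (by omega), this]
  obtain ⟨k, rfl⟩ : ∃ k, i = k + 1 := ⟨i - 1, by omega⟩
  have e1 := excess_succ u c k
  have e2 := excess_succ u c (k + 1)
  have e1' := excess_succ u' c' k
  have e2' := excess_succ u' c' (k + 1)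
  have e0 := hlt k (by omega)
  have hnext : excess u' c' (k + 1 + 1) = excess u c (k + 1 + 1) := by
    rw [e2, e2', e1, e1', e0]
    linarith
  refine ⟨?_, ?_, ?_⟩
  · intro t ht
    rcases lt_or_ge t (k + 1) with h | h
    · exact hlt t h
    · obtain ⟨d, rfl⟩ : ∃ d, t = k + 1 + 1 + d := ⟨t - (k + 1 + 1), by omega⟩
      induction d with
      | zero => exact hnext
      | succ d ih =>
        have := hne (k + 1 + 1 + d + 1) (by omega) (by omega)
        rw [← add_assoc]
        simp only [excess_succ _ _ (k + 1 + 1 + d), ih (by omega) (by omega), this]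
  · rw [Nat.add_sub_cancel, min_le_iff]
    split_ifs at e1 e2 <;> grind
  · rw [Nat.add_sub_cancel, min_le_iff]
    rw [← hnext, ← e0]
    split_ifs at e1' e2' <;> grind

lemma ExcessSim.symm {n i : ℕ} {u c u' c' : Finset ℕ} (hi : 1 ≤ i)
    (h : ExcessSim n i u c u' c') : ExcessSim n i u' c' u c := by
  have h1 := h.eq_of_ne (i - 1) (by omega)
  have h2 := h.eq_of_ne (i + 1) (by omega)
  refine ⟨fun t ht => (h.eq_of_ne t ht).symm, ?_, ?_⟩
  · rw [h1, h2]; exact h.le_right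
  · rw [h1, h2]; exact h.le_left

lemma ExcessSim.Hloc_le {n i : ℕ} {u c u' c' : Finset ℕ} (hin : i < n)
    (hu : u ⊆ Finset.Icc 1 n) (hc : c ⊆ Finset.Icc 1 n) (h : c.card ≤ u.card)
    (hu' : u' ⊆ Finset.Icc 1 n) (hc' : c' ⊆ Finset.Icc 1 n) (h' : c'.card ≤ u'.card)
    (hi : 1 ≤ i) (hs : ExcessSim n i u c u' c') : Hloc n u c ≤ Hloc n u' c' := by
  obtain ⟨-, s, hsn, h2⟩ := Hloc_spec hu hc h
  obtain ⟨h1', -⟩ := Hloc_spec hu' hc' h'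
  by_cases hsi : s = i
  · subst hsi
    have a1 := h1' (s - 1) (by omega)
    have a2 := h1' (s + 1) (by omega)
    have b1 := hs.eq_of_ne (s - 1) (by omega)
    have b2 := hs.eq_of_ne (s + 1) (by omega)
    have := hs.le_left
    omega
  · have a1 := h1' s hsn
    have b1 := hs.eq_of_ne s hsi
    omega

lemma ExcessSim.Hloc_eq {n i : ℕ} {u c u' c' : Finset ℕ} (hin : i < n)
    (hu : u ⊆ Finset.Icc 1 n) (hc : c ⊆ Finset.Icc 1 n) (h : c.card ≤ u.card)
    (hu' : u' ⊆ Finset.Icc 1 n) (hc' : c' ⊆ Finset.Icc 1 n) (h' : c'.card ≤ u'.card)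
    (hi : 1 ≤ i) (hs : ExcessSim n i u c u' c') : Hloc n u' c' = Hloc n u c :=
  le_antisymm (ExcessSim.Hloc_le hin hu' hc' h' hu hc h hi (hs.symm hi))
    (ExcessSim.Hloc_le hin hu hc h hu' hc' h' hi hs)

lemma ExcessSim.kept_imp {n i : ℕ} {u c u' c' : Finset ℕ} (hin : i < n) (hi : 1 ≤ i)
    (hs : ExcessSim n i u c u' c') {a : ℕ} (ha : a ≠ i) (hk : Kept n u c a) :
    Kept n u' c' a := by
  obtain ⟨k1, k2⟩ := hk
  have b1 := hs.eq_of_ne (i - 1) (by omega)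
  have b2 := hs.eq_of_ne (i + 1) (by omega)
  have ba := hs.eq_of_ne a ha
  have bn := hs.eq_of_ne n (by omega)
  have hm := hs.le_right
  refine ⟨?_, ?_⟩
  · intro b hb hbn
    by_cases hbi : b = i
    · subst hbi
      have a2 := k1 (b + 1) (by omega) (by omega)
      by_cases hab : a = b - 1
      · subst hab; omega
      · have a1 := k1 (b - 1) (by omega) (by omega)
        omega
    · have := hs.eq_of_ne b hbi
      have := k1 b hb hbn
      omega
  · intro s hsa
    by_cases hsi : s = i
    · subst hsi
      have a1 := k2 (s - 1) (by omega)
      have a2 := k2 (s + 1) (by omega)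
      omega
    · have := hs.eq_of_ne s hsi
      have := k2 s hsa
      omega

lemma ExcessSim.kept_iff {n i : ℕ} {u c u' c' : Finset ℕ} (hin : i < n) (hi : 1 ≤ i)
    (hs : ExcessSim n i u c u' c') {a : ℕ} (ha : a ≠ i) :
    Kept n u' c' a ↔ Kept n u c a :=
  ⟨ExcessSim.kept_imp hin hi (hs.symm hi) ha, ExcessSim.kept_imp hin hi hs ha⟩

/-- Admissible pairs of columns. -/
structure Adm (n : ℕ) (u c : Finset ℕ) : Prop where
  left : u ⊆ Finset.Icc 1 n
  right : c ⊆ Finset.Icc 1 n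
  card : c.card ≤ u.card

lemma Adm.act_left {n i : ℕ} {u c : Finset ℕ} (h : Adm n u c) (hi : 1 ≤ i) (hin : i < n) :
    Adm n (colAct (Equiv.swap i (i + 1)) u) c :=
  ⟨colAct_swap_subset hi hin h.left, h.right, by rw [card_colAct]; exact h.card⟩

lemma Adm.act_right {n i : ℕ} {u c : Finset ℕ} (h : Adm n u c) (hi : 1 ≤ i) (hin : i < n) :
    Adm n u (colAct (Equiv.swap i (i + 1)) c) :=
  ⟨h.left, colAct_swap_subset hi hin h.right, by rw [card_colAct]; exact h.card⟩

lemma Adm.excess_nonneg {n : ℕ} {u c : Finset ℕ} (h : Adm n u c) : 0 ≤ excess u c n := by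
  have := h.card
  rw [excess_top h.left h.right]; omega

lemma ExcessSim.act_left {n i : ℕ} {u c : Finset ℕ} (h : Adm n u c) (hi : 1 ≤ i) (hin : i < n)
    (hc : i ∈ c → i + 1 ∈ c) : ExcessSim n i u c (colAct (Equiv.swap i (i + 1)) u) c := by
  refine ExcessSim.of_mem hi h.left h.right (h.act_left hi hin).left h.right ?_ ?_ ?_ ?_
  · intro a h1 h2
    exact ⟨mem_colAct_swap_of_ne h1 h2 u, Iff.rfl⟩
  · simp only [mem_colAct_swap_left, mem_colAct_swap_right]; ring
  · tauto
  · tauto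

lemma Hloc_act_left {n i : ℕ} {u c : Finset ℕ} (h : Adm n u c) (hi : 1 ≤ i) (hin : i < n)
    (hc : i ∈ c → i + 1 ∈ c) : Hloc n (colAct (Equiv.swap i (i + 1)) u) c = Hloc n u c :=
  (ExcessSim.act_left h hi hin hc).Hloc_eq hin h.left h.right h.card (h.act_left hi hin).left
    h.right (h.act_left hi hin).card hi

lemma Rright_act_left {n i : ℕ} {u c : Finset ℕ} (h : Adm n u c) (hi : 1 ≤ i) (hin : i < n)
    (h1 : i ∉ c) (h2 : i + 1 ∈ c) :
    Rright n (colAct (Equiv.swap i (i + 1)) u) c = Rright n u c := by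
  by_cases huu : i ∈ u ↔ i + 1 ∈ u
  · rw [colAct_swap_self i u huu]
  have h' := h.act_left hi hin
  have hs := ExcessSim.act_left h hi hin (fun h => absurd h h1)
  have key : ∀ v : Finset ℕ, i ∈ v → i + 1 ∉ v → ¬ Kept n v c i := by
    intro v h3 h4 hk
    have := hk.1 (i + 1) (by omega) (by omega)
    rw [excess_succ] at this
    simp [h2, h4] at this
  ext a
  rw [mem_Rright h.left h.right h.card, mem_Rright h'.left h'.right h'.card]
  by_cases ha : a = i
  · subst ha
    have k1 := key u
    have k2 := key (colAct (Equiv.swap a (a + 1)) u)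
    rw [mem_colAct_swap_left, mem_colAct_swap_right] at k2
    rw [mem_colAct_swap_left]
    tauto
  by_cases ha' : a = i + 1
  · subst ha'; simp [h2]
  · rw [mem_colAct_swap_of_ne ha ha', hs.kept_iff hin hi ha]

lemma Rright_act_left_of_both {n i : ℕ} {u c : Finset ℕ} (h : Adm n u c) (hi : 1 ≤ i)
    (hin : i < n) (h1 : i ∈ c) (h2 : i + 1 ∈ c) :
    Rright n (colAct (Equiv.swap i (i + 1)) u) c = Rright n u c := by
  have h' := h.act_left hi hin
  have hs := ExcessSim.act_left h hi hin (fun _ => h2)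
  ext a
  rw [mem_Rright h.left h.right h.card, mem_Rright h'.left h'.right h'.card]
  by_cases ha : a = i
  · subst ha; simp [h1]
  by_cases ha' : a = i + 1
  · subst ha'; simp [h2]
  · rw [mem_colAct_swap_of_ne ha ha', hs.kept_iff hin hi ha]

lemma kept_succ_iff {n i : ℕ} {v c : Finset ℕ} (hv : Adm n v c) (hi : 1 ≤ i) (hin : i < n)
    (h4 : i + 1 ∉ v) (h5 : i ∉ c) (h6 : i + 1 ∉ c) :
    Kept n (colAct (Equiv.swap i (i + 1)) v) c (i + 1) ↔ Kept n v c i := by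
  have hs := ExcessSim.act_left hv hi hin (fun h => absurd h h5)
  have hn := hv.excess_nonneg
  rw [hs.kept_iff hin hi (by omega)]
  have e2 := excess_succ v c i
  simp only [h4, h6, if_false] at e2
  constructor
  · rintro ⟨a1, a2⟩
    refine ⟨?_, fun s hsi => ?_⟩
    · intro b hb hbn
      by_cases hbi : b = i + 1
      · subst hbi; omega
      · have := a1 b (by omega) hbn; omega
    · have := a2 s (by omega); omega
  · rintro ⟨a1, a2⟩
    refine ⟨fun b hb hbn => ?_, fun s hsi => ?_⟩
    · have := a1 b (by omega) hbn; omega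
    · by_cases hbi : s = i + 1
      · subst hbi; omega
      · have := a2 s (by omega); omega

lemma Rright_act_left_of_none {n i : ℕ} {u c : Finset ℕ} (h : Adm n u c) (hi : 1 ≤ i)
    (hin : i < n) (h1 : i ∉ c) (h2 : i + 1 ∉ c) (hu : ¬ (i ∈ u ↔ i + 1 ∈ u)) :
    Rright n (colAct (Equiv.swap i (i + 1)) u) c
      = colAct (Equiv.swap i (i + 1)) (Rright n u c) := by
  have h' := h.act_left hi hin
  have hs := ExcessSim.act_left h hi hin (fun h => absurd h h1)
  have k1 := kept_succ_iff h hi hin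
  have k2 := kept_succ_iff h' hi hin
  rw [colAct_swap_swap, mem_colAct_swap_right] at k2
  ext a
  rw [mem_Rright h'.left h'.right h'.card]
  by_cases ha : a = i
  · subst ha
    rw [mem_colAct_swap_left, mem_colAct_swap_left, mem_Rright h.left h.right h.card]
    tauto
  by_cases ha' : a = i + 1
  · subst ha'
    rw [mem_colAct_swap_right, mem_colAct_swap_right, mem_Rright h.left h.right h.card]
    tauto
  · rw [mem_colAct_swap_of_ne ha ha', mem_colAct_swap_of_ne ha ha', hs.kept_iff hin hi ha,
      mem_Rright h.left h.right h.card]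

lemma ExcessSim.act_right {n i : ℕ} {u c : Finset ℕ} (h : Adm n u c) (hi : 1 ≤ i) (hin : i < n)
    (h1 : i ∉ c) (hu : i + 1 ∈ u → i ∈ u) :
    ExcessSim n i u c u (colAct (Equiv.swap i (i + 1)) c) := by
  refine ExcessSim.of_mem hi h.left h.right h.left (h.act_right hi hin).right ?_ ?_ ?_ ?_
  · intro a h1 h2
    exact ⟨Iff.rfl, mem_colAct_swap_of_ne h1 h2 c⟩
  · simp only [mem_colAct_swap_left, mem_colAct_swap_right]; ring
  · tauto
  · tauto

lemma Hloc_act_right {n i : ℕ} {u c : Finset ℕ} (h : Adm n u c) (hi : 1 ≤ i) (hin : i < n)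
    (h1 : i ∉ c) (hu : i + 1 ∈ u → i ∈ u) :
    Hloc n u (colAct (Equiv.swap i (i + 1)) c) = Hloc n u c :=
  (ExcessSim.act_right h hi hin h1 hu).Hloc_eq hin h.left h.right h.card h.left
    (h.act_right hi hin).right (h.act_right hi hin).card hi

lemma Rright_act_right {n i : ℕ} {u c : Finset ℕ} (h : Adm n u c) (hi : 1 ≤ i) (hin : i < n)
    (h1 : i ∉ c) (h2 : i + 1 ∈ c) (hu : i + 1 ∈ u → i ∈ u) :
    Rright n u (colAct (Equiv.swap i (i + 1)) c)
      = colAct (Equiv.swap i (i + 1)) (Rright n u c) := by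
  have h' := h.act_right hi hin
  have hs := ExcessSim.act_right h hi hin h1 hu
  have hn := h.excess_nonneg
  ext a
  rw [mem_Rright h'.left h'.right h'.card]
  by_cases ha : a = i
  · subst ha
    rw [mem_colAct_swap_left, mem_colAct_swap_left, mem_Rright h.left h.right h.card]
    tauto
  by_cases ha' : a = i + 1
  · subst ha'
    rw [mem_colAct_swap_right, mem_colAct_swap_right, mem_Rright h.left h.right h.card,
      hs.kept_iff hin hi ha]
    have e2 := excess_succ u c i
    simp only [h2, if_true] at e2
    have key : i ∈ u → (i + 1 ∈ u ∧ Kept n u c (i + 1) ↔ Kept n u c i) := by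
      intro h3
      constructor
      · rintro ⟨h4, a1, a2⟩
        simp only [h4, if_true] at e2
        refine ⟨?_, fun s hsi => ?_⟩
        · intro b hb hbn
          by_cases hbi : b = i + 1
          · subst hbi; omega
          · have := a1 b (by omega) hbn; omega
        · have := a2 s (by omega); omega
      · rintro ⟨a1, a2⟩
        have h4 : i + 1 ∈ u := by
          by_contra h4
          simp only [h4, if_false] at e2
          have := a1 (i + 1) (by omega) (by omega)
          omega
        simp only [h4, if_true] at e2
        refine ⟨h4, fun b hb hbn => ?_, fun s hsi => ?_⟩
        · have := a1 b (by omega) hbn; omega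
        · by_cases hbi : s = i + 1
          · subst hbi; omega
          · have := a2 s (by omega); omega
    tauto
  · rw [mem_colAct_swap_of_ne ha ha', mem_colAct_swap_of_ne ha ha', hs.kept_iff hin hi ha,
      mem_Rright h.left h.right h.card]

lemma lt_of_Rright_lt {n i : ℕ} {u c : Finset ℕ} (h : Adm n u c)
    (hj : i + 1 ∈ Rright n u c) (h_i : i ∉ Rright n u c) :
    i ∉ c ∧ (i + 1 ∈ c ∨ (i + 1 ∈ u ∧ i ∉ u)) := by
  rw [mem_Rright h.left h.right h.card] at hj h_i
  have h1 : i ∉ c := fun h => h_i (Or.inl h)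
  refine ⟨h1, ?_⟩
  by_contra hcon
  push Not at hcon
  obtain ⟨h2, h3⟩ := hcon
  rcases hj with hj | ⟨h4, a1, a2⟩
  · exact h2 hj
  have h5 := h3 h4
  have e2 := excess_succ u c i
  simp only [h2, h4, if_true, if_false] at e2
  apply h_i
  refine Or.inr ⟨h5, ?_, fun s hsi => ?_⟩
  · intro b hb hbn
    by_cases hbi : b = i + 1
    · subst hbi; omega
    · have := a1 b (by omega) hbn; omega
  · have := a2 s (by omega); omega

lemma subset_Rright {n : ℕ} {u c : Finset ℕ} (h : Adm n u c) : c ⊆ Rright n u c := by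
  intro a ha
  rw [mem_Rright h.left h.right h.card]
  exact Or.inl ha

lemma excess_sub_mono {u v : Finset ℕ} (c : Finset ℕ) (huv : u ⊆ v) {s t : ℕ} (hst : s ≤ t) :
    excess v c s - excess u c s ≤ excess v c t - excess u c t := by
  induction t, hst using Nat.le_induction with
  | base => exact le_rfl
  | succ t _ ih =>
    have := @huv (t + 1)
    simp only [excess_succ]
    split_ifs <;> first | omega | (exfalso; tauto)

lemma Rright_mono {n : ℕ} {u v c : Finset ℕ} (h : Adm n u c) (h' : Adm n v c) (huv : u ⊆ v) :
    Rright n u c ⊆ Rright n v c := by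
  intro a ha
  rw [mem_Rright h.left h.right h.card] at ha
  rw [mem_Rright h'.left h'.right h'.card]
  rcases ha with ha | ⟨h1, a1, a2⟩
  · exact Or.inl ha
  have han : a ≤ n := (Finset.mem_Icc.1 (h.left h1)).2
  refine Or.inr ⟨huv h1, fun b hb hbn => ?_, fun s hs => ?_⟩
  · have := a1 b hb hbn
    have := excess_sub_mono c huv hb.le
    omega
  · have := a2 s hs
    have := excess_sub_mono c huv (Nat.zero_le s)
    have := excess_sub_mono c huv han
    have := excess_zero (zero_notMem_of_subset h.left) (zero_notMem_of_subset h.right)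
    have := excess_zero (zero_notMem_of_subset h'.left) (zero_notMem_of_subset h.right)
    omega

lemma Hloc_full {n : ℕ} {c : Finset ℕ} (hc : c ⊆ Finset.Icc 1 n) :
    Hloc n (Finset.Icc 1 n) c = 0 := by
  have h : Adm n (Finset.Icc 1 n) c := ⟨subset_rfl, hc, Finset.card_le_card hc⟩
  obtain ⟨-, s, -, h2⟩ := Hloc_spec h.left h.right h.card
  have : 0 ≤ excess (Finset.Icc 1 n) c s := by
    rw [excess]
    have := Finset.card_le_card (Finset.filter_subset_filter (· ≤ s) hc)
    omega
  omega

lemma Rright_full {n : ℕ} {c : Finset ℕ} (hc : c ⊆ Finset.Icc 1 n) :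
    Rright n (Finset.Icc 1 n) c = Finset.Icc 1 n := by
  have h : Adm n (Finset.Icc 1 n) c := ⟨subset_rfl, hc, Finset.card_le_card hc⟩
  exact Finset.eq_of_subset_of_card_le (Rright_subset h.left h.right h.card)
    (card_Rright h.left h.right h.card).ge

/-- The long cycle `1 → 2 → ⋯ → n → 1`. -/
def rot : ℕ → Equiv.Perm ℕ
  | 0 => 1
  | n + 1 => if n = 0 then 1 else rot n * Equiv.swap n (n + 1)

lemma rot_apply {n : ℕ} (hn : 1 ≤ n) (a : ℕ) :
    rot n a = if a = n then 1 else if 1 ≤ a ∧ a < n then a + 1 else a := by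
  induction n, hn using Nat.le_induction generalizing a with
  | base => simp [rot]; grind
  | succ n hn ih =>
    rw [rot, if_neg (by omega), Equiv.Perm.mul_apply, ih, Equiv.swap_apply_def]
    grind

lemma mem_colAct_rot_one {n : ℕ} (hn : 1 ≤ n) (u : Finset ℕ) :
    1 ∈ colAct (rot n) u ↔ n ∈ u := by
  rw [mem_colAct, show (rot n).symm 1 = n by rw [Equiv.symm_apply_eq, rot_apply hn, if_pos rfl]]

lemma mem_colAct_rot_succ {n : ℕ} {a : ℕ} (ha : 1 ≤ a) (han : a < n) (u : Finset ℕ) :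
    a + 1 ∈ colAct (rot n) u ↔ a ∈ u := by
  rw [mem_colAct, show (rot n).symm (a + 1) = a by
    rw [Equiv.symm_apply_eq, rot_apply (by omega), if_neg (by omega), if_pos ⟨ha, han⟩]]

lemma colAct_rot_subset {n : ℕ} (hn : 1 ≤ n) {u : Finset ℕ} (hu : u ⊆ Finset.Icc 1 n) :
    colAct (rot n) u ⊆ Finset.Icc 1 n := by
  intro a ha
  rw [mem_colAct] at ha
  have h1 := Finset.mem_Icc.1 (hu ha)
  have h2 : rot n ((rot n).symm a) = a := Equiv.apply_symm_apply _ _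
  rw [rot_apply hn] at h2
  rw [Finset.mem_Icc]
  split_ifs at h2 <;> omega

lemma Adm.rot {n : ℕ} (hn : 1 ≤ n) {u c : Finset ℕ} (h : Adm n u c) :
    Adm n (colAct (rot n) u) (colAct (rot n) c) :=
  ⟨colAct_rot_subset hn h.left, colAct_rot_subset hn h.right,
    by rw [card_colAct, card_colAct]; exact h.card⟩

lemma excess_rot {n : ℕ} (hn : 1 ≤ n) {u c : Finset ℕ} (h : Adm n u c) {t : ℕ} (ht : t < n) :
    excess (colAct (_root_.rot n) u) (colAct (_root_.rot n) c) (t + 1) = excess u c t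
      + (if n ∈ u then 1 else 0) - (if n ∈ c then 1 else 0) := by
  induction t with
  | zero =>
    rw [excess_succ, excess_zero (zero_notMem_of_subset (h.rot hn).left)
      (zero_notMem_of_subset (h.rot hn).right), excess_zero (zero_notMem_of_subset h.left)
      (zero_notMem_of_subset h.right)]
    simp only [zero_add, mem_colAct_rot_one hn]
  | succ t ih =>
    rw [excess_succ, ih (by omega), excess_succ u c t]
    simp only [mem_colAct_rot_succ (show 1 ≤ t + 1 by omega) ht]
    ring

lemma Rright_rot {n : ℕ} (hn : 1 ≤ n) {u c : Finset ℕ} (h : Adm n u c) :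
    Rright n (colAct (rot n) u) (colAct (rot n) c) = colAct (rot n) (Rright n u c) := by
  have h' := h.rot hn
  have hR := Rright_subset h.left h.right h.card
  have e := fun t (ht : t < n) => excess_rot hn h ht
  have e0 := excess_zero (zero_notMem_of_subset h.left) (zero_notMem_of_subset h.right)
  have e0' := excess_zero (zero_notMem_of_subset h'.left) (zero_notMem_of_subset h'.right)
  have en := h.excess_nonneg
  obtain ⟨k, rfl⟩ : ∃ k, n = k + 1 := ⟨n - 1, by omega⟩
  have ek := excess_succ u c k
  have ekk := e k (by omega)
  ext a
  by_cases ha : 1 ≤ a ∧ a ≤ k + 1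
  swap
  · constructor
    · intro h1
      exact absurd (Finset.mem_Icc.1 (Rright_subset h'.left h'.right h'.card h1)) ha
    · intro h1
      exact absurd (Finset.mem_Icc.1 (colAct_rot_subset hn hR h1)) ha
  rw [mem_Rright h'.left h'.right h'.card]
  by_cases h1 : a = 1
  · subst h1
    rw [mem_colAct_rot_one hn, mem_colAct_rot_one hn, mem_colAct_rot_one hn,
      mem_Rright h.left h.right h.card]
    by_cases hc : k + 1 ∈ c
    · simp [hc]
    by_cases hu : k + 1 ∈ u
    swap
    · simp [hc, hu]
    simp only [hc, hu, true_and, false_or]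
    simp only [hc, hu, if_true, if_false] at e ek ekk
    have e1 := e 0 (by omega)
    constructor
    · rintro ⟨a1, a2⟩
      refine ⟨by omega, fun s hs => ?_⟩
      by_cases hs1 : s = 0
      · subst hs1; omega
      by_cases hs2 : s = k + 1
      · subst hs2; omega
      have := a1 (s + 1) (by omega) (by omega)
      have := e s (by omega)
      simp only [zero_add] at *
      omega
    · rintro ⟨-, a2⟩
      have hpos : ∀ s ≤ k + 1, 0 ≤ excess u c s := fun s hs => by have := a2 s hs; omega
      have hk := hpos k (by omega)
      simp only [zero_add] at *
      refine ⟨fun b hb hbn => ?_, fun s hs => ?_⟩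
      · obtain ⟨t, rfl⟩ : ∃ t, b = t + 1 := ⟨b - 1, by omega⟩
        have := e t (by omega)
        have := hpos t (by omega)
        omega
      · have : s = 0 ∨ s = 1 := by omega
        rcases this with rfl | rfl <;> omega
  · obtain ⟨t, rfl⟩ : ∃ t, a = t + 1 := ⟨a - 1, by omega⟩
    rw [mem_colAct_rot_succ (by omega) (by omega), mem_colAct_rot_succ (by omega) (by omega),
      mem_colAct_rot_succ (by omega) (by omega), mem_Rright h.left h.right h.card]
    have et := e t (by omega)
    refine or_congr Iff.rfl (and_congr Iff.rfl ⟨?_, ?_⟩)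
    · rintro ⟨a1, a2⟩
      have b2 : ∀ s ≤ t, excess u c t - excess u c s ≤ excess u c (k + 1) := by
        intro s hs
        have := a2 (s + 1) (by omega)
        have := e s (by omega)
        omega
      refine ⟨fun b hb hbn => ?_, b2⟩
      by_cases hbk : b = k + 1
      · subst hbk
        have := b2 0 (by omega)
        omega
      · have := a1 (b + 1) (by omega) (by omega)
        have := e b (by omega)
        omega
    · rintro ⟨a1, a2⟩
      refine ⟨fun b hb hbn => ?_, fun s hs => ?_⟩
      · obtain ⟨r, rfl⟩ : ∃ r, b = r + 1 := ⟨b - 1, by omega⟩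
        have := a1 r (by omega) (by omega)
        have := e r (by omega)
        omega
      · by_cases hs0 : s = 0
        · subst hs0
          by_cases htk : t = k
          · subst htk; omega
          · have := a1 k (by omega) (by omega)
            omega
        · obtain ⟨r, rfl⟩ : ∃ r, s = r + 1 := ⟨s - 1, by omega⟩
          have := a2 r (by omega)
          have := e r (by omega)
          omega

lemma Hloc_rot {n : ℕ} (hn : 1 ≤ n) {u c : Finset ℕ} (h : Adm n u c) :
    Hloc n (colAct (rot n) u) (colAct (rot n) c) + (if n ∈ u then 1 else 0)
      = Hloc n u c + (if n ∈ Rright n u c then 1 else 0) := by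
  have h' := h.rot hn
  have e := fun t (ht : t < n) => excess_rot hn h ht
  have e0 := excess_zero (zero_notMem_of_subset h.left) (zero_notMem_of_subset h.right)
  have e0' := excess_zero (zero_notMem_of_subset h'.left) (zero_notMem_of_subset h'.right)
  have en := h.excess_nonneg
  obtain ⟨k, rfl⟩ : ∃ k, n = k + 1 := ⟨n - 1, by omega⟩
  have ek := excess_succ u c k
  have ekk := e k (by omega)
  obtain ⟨a1, s, hs, a2⟩ := Hloc_spec h.left h.right h.card
  obtain ⟨b1, s', hs', b2⟩ := Hloc_spec h'.left h'.right h'.card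
  have hmem : k + 1 ∈ Rright (k + 1) u c ↔ k + 1 ∈ c ∨ (k + 1 ∈ u ∧ Hloc (k + 1) u c = 0) := by
    rw [mem_Rright h.left h.right h.card]
    refine or_congr Iff.rfl (and_congr Iff.rfl ⟨?_, ?_⟩)
    · rintro ⟨-, c2⟩
      have := c2 s hs
      omega
    · intro h0
      refine ⟨by omega, fun t ht => ?_⟩
      have := a1 t ht
      omega
  have c0 := a1 0 (by omega)
  have c0' := b1 0 (by omega)
  have c1 : s' = 0 ∨ ∃ t, s' = t + 1 := by
    rcases s' with _ | t
    · exact Or.inl rfl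
    · exact Or.inr ⟨t, rfl⟩
  have c2 : ∃ r, r < k + 1 ∧ (Hloc (k + 1) u c : ℤ) = -excess u c r := by
    by_cases hsk : s = k + 1
    · subst hsk
      exact ⟨0, by omega, by omega⟩
    · exact ⟨s, by omega, a2⟩
  obtain ⟨r, hr, c2⟩ := c2
  have c3 := b1 (r + 1) (by omega)
  have c4 := e r hr
  by_cases hu : k + 1 ∈ u <;> by_cases hc : k + 1 ∈ c <;>
    simp only [hu, hc, hmem, true_or, true_and, false_or, false_and, if_true,
      if_false] at * <;>
    rcases c1 with rfl | ⟨t, rfl⟩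
  all_goals first
    | (split_ifs <;> omega)
    | (have d1 := e t (by omega)
       have d2 := a1 t (by omega)
       split_ifs <;> omega)
    | (have d1 := e t (by omega)
       have d2 := a1 t (by omega)
       omega)
    | omega

/-- The carriers of a tableau whose column heights, read from right to left, are `hs`. -/
structure ValidSt (n : ℕ) (hs : List ℕ) (us : List (Finset ℕ)) : Prop where
  fits : List.Forall₂ (fun h u => u ⊆ Finset.Icc 1 n ∧ u.card = h) hs us
  chain : us.Pairwise (· ⊆ ·)

/-- Moving every carrier through a new column. -/
def carry (n : ℕ) (c : Finset ℕ) (us : List (Finset ℕ)) : List (Finset ℕ) :=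
  c :: us.map fun u => Rright n u c

/-- The energy picked up when every carrier moves through a new column. -/
def carryE (n : ℕ) (c : Finset ℕ) (us : List (Finset ℕ)) : ℕ :=
  (us.map fun u => Hloc n u c).sum

/-- The swap of `i` and `i + 1` acting on a list of columns. -/
def swapAct (i : ℕ) (us : List (Finset ℕ)) : List (Finset ℕ) :=
  us.map (colAct (Equiv.swap i (i + 1)))

lemma forall₂_exists_left {α β : Type*} {R : α → β → Prop} {l : List α} {l' : List β}
    (h : List.Forall₂ R l l') : ∀ b ∈ l', ∃ a ∈ l, R a b := by
  induction h with
  | nil => simp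
  | cons hab _ ih =>
    intro b hb
    rcases List.mem_cons.1 hb with rfl | hb
    · exact ⟨_, List.mem_cons_self, hab⟩
    · obtain ⟨a, ha, hr⟩ := ih b hb
      exact ⟨a, List.mem_cons_of_mem _ ha, hr⟩

lemma ValidSt.adm {n h : ℕ} {hs : List ℕ} {us : List (Finset ℕ)} (hv : ValidSt n hs us)
    (hh : ∀ k ∈ hs, h ≤ k) {c : Finset ℕ} (hc : c ∈ (Finset.Icc 1 n).powersetCard h)
    {u : Finset ℕ} (hu : u ∈ us) : Adm n u c := by
  obtain ⟨k, hk, h1, h2⟩ := forall₂_exists_left hv.fits u hu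
  rw [Finset.mem_powersetCard] at hc
  exact ⟨h1, hc.1, by rw [h2, hc.2]; exact hh k hk⟩

lemma ValidSt.carry {n h : ℕ} {hs : List ℕ} {us : List (Finset ℕ)} (hv : ValidSt n hs us)
    (hh : ∀ k ∈ hs, h ≤ k) {c : Finset ℕ} (hc : c ∈ (Finset.Icc 1 n).powersetCard h) :
    ValidSt n (h :: hs) (carry n c us) := by
  have hA : ∀ u ∈ us, Adm n u c := fun u hu => hv.adm hh hc hu
  refine ⟨?_, ?_⟩
  · refine List.Forall₂.cons (Finset.mem_powersetCard.1 hc) ?_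
    rw [List.forall₂_map_right_iff]
    have hf := hv.fits
    clear hv hh
    induction hf with
    | nil => exact List.Forall₂.nil
    | @cons a u l l' hab _ ih =>
      have hu := hA u List.mem_cons_self
      refine List.Forall₂.cons ⟨Rright_subset hu.left hu.right hu.card, ?_⟩
        (ih fun v hv => hA v (List.mem_cons_of_mem _ hv))
      rw [card_Rright hu.left hu.right hu.card, hab.2]
  · rw [_root_.carry, List.pairwise_cons]
    refine ⟨?_, ?_⟩
    · intro v hv
      obtain ⟨u, hu, rfl⟩ := List.mem_map.1 hv
      exact subset_Rright (hA u hu)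
    · rw [List.pairwise_map]
      exact hv.chain.imp_of_mem fun {u v} hu hv huv => Rright_mono (hA u hu) (hA v hv) huv

lemma ValidSt.comparable {n : ℕ} {hs : List ℕ} {us : List (Finset ℕ)} (hv : ValidSt n hs us)
    {u v : Finset ℕ} (hu : u ∈ us) (hw : v ∈ us) : u ⊆ v ∨ v ⊆ u := by
  have h := List.pairwise_iff_getElem.1 hv.chain
  obtain ⟨a, ha, rfl⟩ := List.getElem_of_mem hu
  obtain ⟨b, hb, rfl⟩ := List.getElem_of_mem hw
  rcases lt_trichotomy a b with hab | rfl | hab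
  · exact Or.inl (h a b ha hb hab)
  · exact Or.inl subset_rfl
  · exact Or.inr (h b a hb ha hab)

section CarrierStep

variable {n i h : ℕ} {hs : List ℕ} {us : List (Finset ℕ)} {c : Finset ℕ}

lemma carryE_swapAct (hi : 1 ≤ i) (hin : i < n) (hA : ∀ u ∈ us, Adm n u c)
    (hc : i ∈ c → i + 1 ∈ c) : carryE n c (swapAct i us) = carryE n c us := by
  rw [carryE, carryE, swapAct, List.map_map]
  congr 1
  exact List.map_congr_left fun u hu => Hloc_act_left (hA u hu) hi hin hc

lemma carry_swapAct_of_lt (hi : 1 ≤ i) (hin : i < n) (hA : ∀ u ∈ us, Adm n u c)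
    (h1 : i ∉ c) (h2 : i + 1 ∈ c) : carry n c (swapAct i us) = carry n c us := by
  rw [carry, carry, swapAct, List.map_map]
  congr 1
  exact List.map_congr_left fun u hu => Rright_act_left (hA u hu) hi hin h1 h2

lemma carry_swapAct_of_both (hi : 1 ≤ i) (hin : i < n) (hA : ∀ u ∈ us, Adm n u c)
    (h1 : i ∈ c) (h2 : i + 1 ∈ c) : carry n c (swapAct i us) = carry n c us := by
  rw [carry, carry, swapAct, List.map_map]
  congr 1
  exact List.map_congr_left fun u hu => Rright_act_left_of_both (hA u hu) hi hin h1 h2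

lemma carry_swapAct_of_none (hv : ValidSt n hs us) (hi : 1 ≤ i) (hin : i < n)
    (hA : ∀ u ∈ us, Adm n u c) (h1 : i ∉ c) (h2 : i + 1 ∉ c) :
    carry n c (swapAct i us) = carry n c us ∨
      carry n c (swapAct i us) = swapAct i (carry n c us) := by
  by_cases hB : ∃ v ∈ us, i ∈ v ∧ i + 1 ∈ v ∧ ¬ (i ∈ Rright n v c ↔ i + 1 ∈ Rright n v c)
  · obtain ⟨v, hvu, hv1, hv2, hv3⟩ := hB
    left
    rw [carry, carry, swapAct, List.map_map]
    congr 1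
    refine List.map_congr_left fun u hu => ?_
    simp only [Function.comp_apply]
    by_cases huu : i ∈ u ↔ i + 1 ∈ u
    · rw [colAct_swap_self i u huu]
    have hAu := hA u hu
    have hR := Rright_act_left_of_none hAu hi hin h1 h2 huu
    have huv : u ⊆ v := by
      rcases hv.comparable hu hvu with h | h
      · exact h
      · exact absurd ⟨fun _ => h hv2, fun _ => h hv1⟩ huu
    have huv' : colAct (Equiv.swap i (i + 1)) u ⊆ v := by
      intro a ha
      by_cases ha1 : a = i
      · rwa [ha1]
      by_cases ha2 : a = i + 1
      · rwa [ha2]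
      · exact huv ((mem_colAct_swap_of_ne ha1 ha2 u).1 ha)
    have m1 := Rright_mono hAu (hA v hvu) huv
    have m2 := Rright_mono (hAu.act_left hi hin) (hA v hvu) huv'
    rw [hR] at m2 ⊢
    have n1 := @m2 i
    have n2 := @m2 (i + 1)
    rw [mem_colAct_swap_left] at n1
    rw [mem_colAct_swap_right] at n2
    have o1 := @m1 i
    have o2 := @m1 (i + 1)
    exact colAct_swap_self i _ ⟨fun h => absurd ⟨fun _ => n2 h, fun _ => o1 h⟩ hv3,
      fun h => absurd ⟨fun _ => o2 h, fun _ => n1 h⟩ hv3⟩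
  · push Not at hB
    right
    rw [carry, carry, swapAct, List.map_map, swapAct, List.map_cons, List.map_map,
      colAct_swap_self i c (iff_of_false h1 h2)]
    congr 1
    refine List.map_congr_left fun u hu => ?_
    simp only [Function.comp_apply]
    by_cases huu : i ∈ u ↔ i + 1 ∈ u
    · have hAu := hA u hu
      rw [colAct_swap_self i u huu, colAct_swap_self i]
      by_cases hu1 : i ∈ u
      · exact hB u hu hu1 (huu.1 hu1)
      · have hu2 : i + 1 ∉ u := fun h => hu1 (huu.2 h)
        rw [mem_Rright hAu.left hAu.right hAu.card, mem_Rright hAu.left hAu.right hAu.card]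
        simp only [h1, h2, hu1, hu2, false_and, or_self]
    · exact Rright_act_left_of_none (hA u hu) hi hin h1 h2 huu

lemma carryE_act (hi : 1 ≤ i) (hin : i < n) (hA : ∀ u ∈ us, Adm n u c)
    (h1 : i ∉ c) (hus : ∀ u ∈ us, i + 1 ∈ u → i ∈ u) :
    carryE n (colAct (Equiv.swap i (i + 1)) c) us = carryE n c us := by
  rw [carryE, carryE]
  congr 1
  exact List.map_congr_left fun u hu => Hloc_act_right (hA u hu) hi hin h1 (hus u hu)

lemma carry_act (hi : 1 ≤ i) (hin : i < n) (hA : ∀ u ∈ us, Adm n u c)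
    (h1 : i ∉ c) (h2 : i + 1 ∈ c) (hus : ∀ u ∈ us, i + 1 ∈ u → i ∈ u) :
    carry n (colAct (Equiv.swap i (i + 1)) c) us = swapAct i (carry n c us) := by
  rw [carry, carry, swapAct, List.map_cons, List.map_map]
  congr 1
  exact List.map_congr_left fun u hu => Rright_act_right (hA u hu) hi hin h1 h2 (hus u hu)

end CarrierStep

open MvPolynomial in
/-- The weighted generating polynomial of the tableaux whose column heights, read from right to
left, are `hs`, the weight being a function of the carriers. -/
noncomputable def wsum (n : ℕ) (q : ℂ) :
    List ℕ → (List (Finset ℕ) → ℂ) → MvPolynomial ℕ ℂ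
  | [], φ => C (φ [])
  | h :: hs, φ => ∑ c ∈ (Finset.Icc 1 n).powersetCard h,
      (∏ a ∈ c, X a) * wsum n q hs fun us => q ^ carryE n c us * φ (carry n c us)

lemma wsum_congr {n : ℕ} {q : ℂ} {hs : List ℕ} (hhs : hs.Pairwise (· ≤ ·))
    {φ ψ : List (Finset ℕ) → ℂ} (h : ∀ us, ValidSt n hs us → φ us = ψ us) :
    wsum n q hs φ = wsum n q hs ψ := by
  induction hs generalizing φ ψ with
  | nil => simp only [wsum]; rw [h [] ⟨List.Forall₂.nil, List.Pairwise.nil⟩]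
  | cons k hs ih =>
    rw [List.pairwise_cons] at hhs
    simp only [wsum]
    refine Finset.sum_congr rfl fun c hc => ?_
    rw [ih hhs.2 fun us hus => by rw [h _ (hus.carry hhs.1 hc)]]

lemma wsum_add (n : ℕ) (q : ℂ) (hs : List ℕ) (φ ψ : List (Finset ℕ) → ℂ) :
    wsum n q hs (fun us => φ us + ψ us) = wsum n q hs φ + wsum n q hs ψ := by
  induction hs generalizing φ ψ with
  | nil => simp [wsum]
  | cons k hs ih => simp only [wsum, mul_add, ih, Finset.sum_add_distrib]

lemma wsum_const_mul (n : ℕ) (q : ℂ) (hs : List ℕ) (a : ℂ) (φ : List (Finset ℕ) → ℂ) :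
    wsum n q hs (fun us => a * φ us) = MvPolynomial.C a * wsum n q hs φ := by
  induction hs generalizing φ with
  | nil => simp [wsum]
  | cons k hs ih =>
    simp only [wsum, Finset.mul_sum]
    refine Finset.sum_congr rfl fun c _ => ?_
    rw [mul_left_comm (MvPolynomial.C a), ← ih]
    simp only [mul_left_comm a]

lemma wsum_eq_zero {n : ℕ} {q : ℂ} {hs : List ℕ} (hhs : hs.Pairwise (· ≤ ·))
    {φ : List (Finset ℕ) → ℂ} (h : ∀ us, ValidSt n hs us → φ us = 0) : wsum n q hs φ = 0 := by
  rw [wsum_congr hhs (ψ := fun _ => 0 * 0) (by simpa using h), wsum_const_mul]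
  simp

lemma wsum_sub (n : ℕ) (q : ℂ) (hs : List ℕ) (φ ψ : List (Finset ℕ) → ℂ) :
    wsum n q hs (fun us => φ us - ψ us) = wsum n q hs φ - wsum n q hs ψ := by
  have := wsum_add n q hs (fun us => φ us - ψ us) ψ
  simp only [sub_add_cancel] at this
  rw [this, add_sub_cancel_right]

lemma prod_X_colAct (σ : Equiv.Perm ℕ) (c : Finset ℕ) :
    (∏ a ∈ colAct σ c, MvPolynomial.X a : MvPolynomial ℕ ℂ)
      = MvPolynomial.rename σ (∏ a ∈ c, MvPolynomial.X a) := by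
  rw [colAct, Finset.prod_map, map_prod]
  simp

lemma rename_swap_prod_X {i : ℕ} {c : Finset ℕ} (h1 : i ∉ c) (h2 : i + 1 ∈ c) :
    ∃ m : MvPolynomial ℕ ℂ, (∏ a ∈ c, MvPolynomial.X a) = MvPolynomial.X (i + 1) * m ∧
      (∏ a ∈ colAct (Equiv.swap i (i + 1)) c, MvPolynomial.X a) = MvPolynomial.X i * m := by
  refine ⟨∏ a ∈ c.erase (i + 1), MvPolynomial.X a, (Finset.mul_prod_erase _ _ h2).symm, ?_⟩
  rw [prod_X_colAct, ← Finset.mul_prod_erase _ _ h2, map_mul, MvPolynomial.rename_X,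
    Equiv.swap_apply_right, map_prod]
  congr 1
  refine Finset.prod_congr rfl fun a ha => ?_
  rw [Finset.mem_erase] at ha
  rw [MvPolynomial.rename_X, Equiv.swap_apply_of_ne_of_ne (fun h => h1 (by rw [← h]; exact ha.2)) ha.1]

/-- A weight that is invariant under the swap of `i` and `i + 1`. -/
def SwapInv (n i : ℕ) (hs : List ℕ) (φ : List (Finset ℕ) → ℂ) : Prop :=
  ∀ us, ValidSt n hs us → φ (swapAct i us) = φ us

/-- A weight that vanishes unless some carrier contains `i + 1` but not `i`. -/
def SuppLt (n i : ℕ) (hs : List ℕ) (φ : List (Finset ℕ) → ℂ) : Prop :=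
  ∀ us, ValidSt n hs us → (∀ u ∈ us, i + 1 ∈ u → i ∈ u) → φ us = 0

section Exchange

variable {n i h : ℕ} {hs : List ℕ} {c : Finset ℕ} {q : ℂ} {φ : List (Finset ℕ) → ℂ}

lemma swapInv_of_lt (hi : 1 ≤ i) (hin : i < n) (hh : ∀ k ∈ hs, h ≤ k)
    (hc : c ∈ (Finset.Icc 1 n).powersetCard h) (h1 : i ∉ c) (h2 : i + 1 ∈ c) :
    SwapInv n i hs fun us => q ^ carryE n c us * φ (carry n c us) := by
  intro us hv
  have hA : ∀ u ∈ us, Adm n u c := fun u hu => hv.adm hh hc hu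
  simp only
  rw [carryE_swapAct hi hin hA fun h => absurd h h1, carry_swapAct_of_lt hi hin hA h1 h2]

lemma swapInv_of_iff (hφ : SwapInv n i (h :: hs) φ) (hi : 1 ≤ i) (hin : i < n)
    (hh : ∀ k ∈ hs, h ≤ k) (hc : c ∈ (Finset.Icc 1 n).powersetCard h) (h1 : i ∈ c ↔ i + 1 ∈ c) :
    SwapInv n i hs fun us => q ^ carryE n c us * φ (carry n c us) := by
  intro us hv
  have hA : ∀ u ∈ us, Adm n u c := fun u hu => hv.adm hh hc hu
  simp only
  rw [carryE_swapAct hi hin hA h1.1]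
  by_cases h2 : i ∈ c
  · rw [carry_swapAct_of_both hi hin hA h2 (h1.1 h2)]
  · rcases carry_swapAct_of_none hv hi hin hA h2 (fun h => h2 (h1.2 h)) with h | h
    · rw [h]
    · rw [h, hφ _ (hv.carry hh hc)]

lemma suppLt_sub (hφ : SwapInv n i (h :: hs) φ) (hi : 1 ≤ i) (hin : i < n)
    (hh : ∀ k ∈ hs, h ≤ k) (hc : c ∈ (Finset.Icc 1 n).powersetCard h)
    (h1 : i ∉ c) (h2 : i + 1 ∈ c) :
    SuppLt n i hs fun us => q ^ carryE n (colAct (Equiv.swap i (i + 1)) c) us *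
        φ (carry n (colAct (Equiv.swap i (i + 1)) c) us)
      - q ^ carryE n c us * φ (carry n c us) := by
  intro us hv hus
  have hA : ∀ u ∈ us, Adm n u c := fun u hu => hv.adm hh hc hu
  simp only
  rw [carryE_act hi hin hA h1 hus, carry_act hi hin hA h1 h2 hus, hφ _ (hv.carry hh hc), sub_self]

lemma eq_zero_of_suppLt (hφ : SuppLt n i (h :: hs) φ)
    (hh : ∀ k ∈ hs, h ≤ k) (hc : c ∈ (Finset.Icc 1 n).powersetCard h) (h1 : i ∈ c)
    {us : List (Finset ℕ)} (hv : ValidSt n hs us) : φ (carry n c us) = 0 := by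
  refine hφ _ (hv.carry hh hc) fun v hv' => ?_
  rcases List.mem_cons.1 hv' with rfl | hv'
  · exact fun _ => h1
  · obtain ⟨u, hu, rfl⟩ := List.mem_map.1 hv'
    exact fun _ => subset_Rright (hv.adm hh hc hu) h1

lemma suppLt_of_none (hφ : SuppLt n i (h :: hs) φ)
    (hh : ∀ k ∈ hs, h ≤ k) (hc : c ∈ (Finset.Icc 1 n).powersetCard h) (h2 : i + 1 ∉ c) :
    SuppLt n i hs fun us => q ^ carryE n c us * φ (carry n c us) := by
  intro us hv hus
  simp only
  rw [hφ _ (hv.carry hh hc), mul_zero]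
  intro v hv'
  rcases List.mem_cons.1 hv' with rfl | hv'
  · exact fun h => absurd h h2
  · obtain ⟨u, hu, rfl⟩ := List.mem_map.1 hv'
    intro h3
    by_contra h4
    obtain ⟨-, h5⟩ := lt_of_Rright_lt (hv.adm hh hc hu) h3 h4
    have := hus u hu
    tauto

end Exchange

lemma colAct_swap_mem_powersetCard {n i h : ℕ} (hi : 1 ≤ i) (hin : i < n) {c : Finset ℕ}
    (hc : c ∈ (Finset.Icc 1 n).powersetCard h) :
    colAct (Equiv.swap i (i + 1)) c ∈ (Finset.Icc 1 n).powersetCard h := by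
  rw [Finset.mem_powersetCard] at hc ⊢
  exact ⟨colAct_swap_subset hi hin hc.1, by rw [card_colAct, hc.2]⟩

open MvPolynomial in
theorem wsum_exchange {n i : ℕ} (q : ℂ) (hi : 1 ≤ i) (hin : i < n) {hs : List ℕ}
    (hhs : hs.Pairwise (· ≤ ·)) :
    (∀ φ, SwapInv n i hs φ →
      rename (Equiv.swap i (i + 1)) (wsum n q hs φ) = wsum n q hs φ) ∧
    ∀ φ, SuppLt n i hs φ →
      X (i + 1) * rename (Equiv.swap i (i + 1)) (wsum n q hs φ) = X i * wsum n q hs φ := by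
  induction hs with
  | nil =>
    refine ⟨fun φ _ => by simp [wsum], fun φ hφ => ?_⟩
    rw [wsum, hφ [] ⟨List.Forall₂.nil, List.Pairwise.nil⟩ (by simp)]
    simp
  | cons h hs ih =>
    rw [List.pairwise_cons] at hhs
    obtain ⟨hh, hhs⟩ := hhs
    obtain ⟨ih1, ih2⟩ := ih hhs
    set s := Equiv.swap i (i + 1) with hs_def
    refine ⟨fun φ hφ => ?_, fun φ hφ => ?_⟩
    · set G : Finset ℕ → MvPolynomial ℕ ℂ :=
        fun c => wsum n q hs fun us => q ^ carryE n c us * φ (carry n c us) with hG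
      have hpair : ∀ c ∈ (Finset.Icc 1 n).powersetCard h, i ∉ c → i + 1 ∈ c →
          (∏ a ∈ c, X a) * (rename s (G (colAct s c)) - G c) +
            (∏ a ∈ colAct s c, X a) * (rename s (G c) - G (colAct s c)) = 0 := by
        intro c hc h1 h2
        obtain ⟨m, hm1, hm2⟩ := rename_swap_prod_X h1 h2
        rw [hm1, hm2]
        have e1 : rename s (G c) = G c := ih1 _ (swapInv_of_lt hi hin hh hc h1 h2)
        have e2 := ih2 _ (suppLt_sub (q := q) hφ hi hin hh hc h1 h2)
        rw [wsum_sub] at e2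
        change X (i + 1) * rename s (G (colAct s c) - G c) = X i * (G (colAct s c) - G c) at e2
        rw [map_sub, e1] at e2
        rw [e1]
        linear_combination m * e2
      have key : ∑ c ∈ (Finset.Icc 1 n).powersetCard h,
          (∏ a ∈ c, X a) * (rename s (G (colAct s c)) - G c) = 0 := by
        refine Finset.sum_involution (fun c _ => colAct s c) ?_ ?_ ?_ ?_
        · intro c hc
          rw [hs_def, colAct_swap_swap, ← hs_def]
          by_cases hcc : i ∈ c ↔ i + 1 ∈ c
          · have e1 : rename s (G c) = G c := ih1 _ (swapInv_of_iff hφ hi hin hh hc hcc)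
            rw [hs_def, colAct_swap_self i c hcc, ← hs_def, e1]
            ring
          by_cases h1 : i ∈ c
          · have h2 : i + 1 ∉ c := by tauto
            have := hpair (colAct s c) (colAct_swap_mem_powersetCard hi hin hc)
              (by rwa [hs_def, mem_colAct_swap_left]) (by rwa [hs_def, mem_colAct_swap_right])
            rw [hs_def, colAct_swap_swap, ← hs_def] at this
            rw [add_comm]; exact this
          · exact hpair c hc h1 (by tauto)
        · intro c hc hne heq
          apply hne
          have hcc : i ∈ c ↔ i + 1 ∈ c := by
            rw [← mem_colAct_swap_left i c, ← hs_def, heq]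
          have e1 : rename s (G c) = G c := ih1 _ (swapInv_of_iff hφ hi hin hh hc hcc)
          rw [heq, e1]
          ring
        · intro c hc; exact colAct_swap_mem_powersetCard hi hin hc
        · intro c hc; exact colAct_swap_swap i c
      simp only [mul_sub, Finset.sum_sub_distrib] at key
      rw [sub_eq_zero] at key
      rw [wsum, map_sum, ← key]
      refine Finset.sum_bij (fun c _ => colAct s c)
        (fun c hc => colAct_swap_mem_powersetCard hi hin hc) ?_ ?_ ?_
      · intro a _ b _ hab
        rw [← colAct_swap_swap i a, ← hs_def, hab, hs_def, colAct_swap_swap]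
      · intro b hb
        exact ⟨colAct s b, colAct_swap_mem_powersetCard hi hin hb, colAct_swap_swap i b⟩
      · intro c hc
        rw [map_mul, ← prod_X_colAct, hs_def, colAct_swap_swap]
    · rw [wsum, map_sum, Finset.mul_sum, Finset.mul_sum]
      refine Finset.sum_congr rfl fun c hc => ?_
      rw [map_mul, ← prod_X_colAct]
      by_cases h1 : i ∈ c
      · rw [wsum_eq_zero hhs fun us hv => by rw [eq_zero_of_suppLt hφ hh hc h1 hv, mul_zero]]
        simp
      by_cases h2 : i + 1 ∈ c
      · obtain ⟨m, hm1, hm2⟩ := rename_swap_prod_X h1 h2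
        rw [hm1, hs_def, hm2, ← hs_def, ih1 _ (swapInv_of_lt hi hin hh hc h1 h2)]
        ring
      · rw [hs_def, colAct_swap_self i c (by tauto), ← hs_def]
        linear_combination (∏ a ∈ c, X a) * ih2 _ (suppLt_of_none (q := q) hφ hh hc h2)

open MvPolynomial in
/-- The substitution `X m ↦ q X m`. -/
noncomputable def scaleVar (q : ℂ) (m : ℕ) : MvPolynomial ℕ ℂ →ₐ[ℂ] MvPolynomial ℕ ℂ :=
  aeval fun a => if a = m then C q * X a else X a

lemma scaleVar_X (q : ℂ) (m a : ℕ) : scaleVar q m (MvPolynomial.X a)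
    = if a = m then MvPolynomial.C q * MvPolynomial.X a else MvPolynomial.X a := by
  rw [scaleVar, MvPolynomial.aeval_X]

lemma scaleVar_C (q : ℂ) (m : ℕ) (z : ℂ) : scaleVar q m (MvPolynomial.C z) = MvPolynomial.C z := by
  rw [scaleVar, MvPolynomial.aeval_C]; rfl

lemma scaleVar_prod_X (q : ℂ) (m : ℕ) (c : Finset ℕ) :
    scaleVar q m (∏ a ∈ c, MvPolynomial.X a)
      = MvPolynomial.C (q ^ (if m ∈ c then 1 else 0)) * ∏ a ∈ c, MvPolynomial.X a := by
  have h : ∀ a, scaleVar q m (MvPolynomial.X a)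
      = (if a = m then MvPolynomial.C q else 1) * MvPolynomial.X a := by
    intro a; rw [scaleVar_X]; split_ifs <;> simp
  rw [map_prod]
  simp only [h]
  rw [Finset.prod_mul_distrib, Finset.prod_ite_eq']
  split_ifs <;> simp

lemma rename_scaleVar (q : ℂ) (m : ℕ) (σ : Equiv.Perm ℕ) (p : MvPolynomial ℕ ℂ) :
    MvPolynomial.rename σ (scaleVar q m p) = scaleVar q (σ m) (MvPolynomial.rename σ p) := by
  have : (MvPolynomial.rename (R := ℂ) σ).comp (scaleVar q m)
      = (scaleVar q (σ m)).comp (MvPolynomial.rename σ) := by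
    ext1 a
    simp only [AlgHom.comp_apply, scaleVar_X, MvPolynomial.rename_X, σ.injective.eq_iff]
    split_ifs <;> simp
  exact congrArg (fun f => f p) this

lemma colAct_rot_Icc {n : ℕ} (hn : 1 ≤ n) : colAct (rot n) (Finset.Icc 1 n) = Finset.Icc 1 n :=
  Finset.eq_of_subset_of_card_le (colAct_rot_subset hn subset_rfl) (card_colAct _ _).ge

lemma sum_powersetCard_rot {M : Type*} [AddCommMonoid M] {n : ℕ} (hn : 1 ≤ n) (h : ℕ)
    (f : Finset ℕ → M) :
    ∑ c ∈ (Finset.Icc 1 n).powersetCard h, f (colAct (rot n) c)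
      = ∑ c ∈ (Finset.Icc 1 n).powersetCard h, f c := by
  have h1 : (Finset.Icc 1 n).powersetCard h = ((Finset.Icc 1 n).powersetCard h).map
      (Finset.mapEmbedding (rot n).toEmbedding).toEmbedding := by
    rw [← Finset.powersetCard_map]
    congr 1
    exact (colAct_rot_Icc hn).symm
  conv_rhs => rw [h1, Finset.sum_map]
  rfl

lemma carry_rot {n : ℕ} (hn : 1 ≤ n) {us : List (Finset ℕ)} {c : Finset ℕ}
    (hA : ∀ u ∈ us, Adm n u c) :
    carry n (colAct (rot n) c) (us.map (colAct (rot n))) = (carry n c us).map (colAct (rot n)) := by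
  rw [carry, carry, List.map_cons, List.map_map, List.map_map]
  congr 1
  exact List.map_congr_left fun u hu => Rright_rot hn (hA u hu)

lemma carryE_rot {n : ℕ} (hn : 1 ≤ n) {us : List (Finset ℕ)} {c : Finset ℕ}
    (hA : ∀ u ∈ us, Adm n u c) :
    carryE n (colAct (rot n) c) (us.map (colAct (rot n))) + us.countP (n ∈ ·)
        + (if n ∈ c then 1 else 0)
      = carryE n c us + (carry n c us).countP (n ∈ ·) := by
  have h : carryE n (colAct (rot n) c) (us.map (colAct (rot n))) + us.countP (n ∈ ·)
      = carryE n c us + (us.map fun u => Rright n u c).countP (n ∈ ·) := by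
    simp only [carryE]
    induction us with
    | nil => simp
    | cons u us ih =>
      have h1 := ih fun v hv => hA v (List.mem_cons_of_mem _ hv)
      have h2 := Hloc_rot hn (hA u List.mem_cons_self)
      simp only [List.map_cons, List.sum_cons, List.countP_cons, decide_eq_true_eq] at h1 ⊢
      omega
  rw [h, carry, List.countP_cons]
  simp only [decide_eq_true_eq]
  omega

lemma rename_rot_wsum {n : ℕ} (hn : 1 ≤ n) (q : ℂ) {hs : List ℕ} (hhs : hs.Pairwise (· ≤ ·))
    (φ : List (Finset ℕ) → ℂ) :
    MvPolynomial.rename (rot n)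
        (wsum n q hs fun us => q ^ us.countP (n ∈ ·) * φ (us.map (colAct (rot n))))
      = scaleVar q 1 (wsum n q hs φ) := by
  induction hs generalizing φ with
  | nil => simp [wsum]
  | cons h hs ih =>
    rw [List.pairwise_cons] at hhs
    obtain ⟨hh, hhs⟩ := hhs
    conv_rhs => rw [wsum, ← sum_powersetCard_rot hn]
    rw [wsum, map_sum, map_sum]
    refine Finset.sum_congr rfl fun c hc => ?_
    rw [map_mul, map_mul, scaleVar_prod_X, ← ih hhs, prod_X_colAct]
    rw [wsum_congr hhs (ψ := fun us => q ^ (if n ∈ c then 1 else 0) * (q ^ us.countP (n ∈ ·) *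
      (q ^ carryE n (colAct (rot n) c) (us.map (colAct (rot n))) *
        φ (carry n (colAct (rot n) c) (us.map (colAct (rot n)))))))]
    · rw [wsum_const_mul, map_mul, MvPolynomial.rename_C]
      simp only [mem_colAct_rot_one hn]
      ring
    · intro us hv
      have hA : ∀ u ∈ us, Adm n u c := fun u hu => hv.adm hh hc hu
      rw [carry_rot hn hA, ← mul_assoc, ← mul_assoc, ← mul_assoc, ← pow_add, ← pow_add, ← pow_add,
        ← carryE_rot hn hA]
      congr 2
      ring

/-- The `q`-Whittaker polynomial as a polynomial, indexed by the column heights read from right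
to left. -/
noncomputable def wpoly (n : ℕ) (q : ℂ) (hs : List ℕ) : MvPolynomial ℕ ℂ :=
  wsum n q hs fun _ => 1

lemma rename_swap_wpoly {n i : ℕ} (q : ℂ) (hi : 1 ≤ i) (hin : i < n) {hs : List ℕ}
    (hhs : hs.Pairwise (· ≤ ·)) :
    MvPolynomial.rename (Equiv.swap i (i + 1)) (wpoly n q hs) = wpoly n q hs :=
  (wsum_exchange q hi hin hhs).1 _ fun _ _ => rfl

lemma rename_rot_of_symm {n : ℕ} {p : MvPolynomial ℕ ℂ}
    (hp : ∀ i, 1 ≤ i → i < n → MvPolynomial.rename (Equiv.swap i (i + 1)) p = p) :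
    MvPolynomial.rename (rot n) p = p := by
  have : ∀ m ≤ n, MvPolynomial.rename (rot m) p = p := by
    intro m
    induction m with
    | zero => intro _; simp [rot]
    | succ m ih =>
      intro hm
      rw [rot]
      split_ifs with h0
      · simp
      · rw [Equiv.Perm.coe_mul, ← MvPolynomial.rename_rename, hp m (by omega) (by omega),
          ih (by omega)]
  exact this n le_rfl

open MvPolynomial in
/-- A sequence of polynomials interpolating between `F` and `G` by Hecke-type relations. -/
def QChain (n : ℕ) (G F : MvPolynomial ℕ ℂ) : Prop :=
  ∃ g : ℕ → MvPolynomial ℕ ℂ, g n = G ∧ g 1 = F ∧ ∀ k, 1 ≤ k → k < n →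
    rename (Equiv.swap k (k + 1)) (g k) = g k ∧
    X k * (g (k + 1) - g k) = X (k + 1) * rename (Equiv.swap k (k + 1)) (g (k + 1) - g k)

lemma countP_full {n : ℕ} {hs : List ℕ} {us : List (Finset ℕ)} (hv : ValidSt n hs us) :
    us.countP (Finset.Icc 1 n ⊆ ·) = hs.count n := by
  have h := hv.fits
  clear hv
  induction h with
  | nil => simp
  | @cons a u l l' hab _ ih =>
    rw [List.countP_cons, List.count_cons, ih]
    congr 1
    have : Finset.Icc 1 n ⊆ u ↔ a = n := by
      rw [← hab.2]
      constructor
      · intro h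
        rw [hab.1.antisymm h]; simp
      · intro h
        rw [Finset.eq_of_subset_of_card_le hab.1 (by rw [h]; simp)]
    simp [this]

theorem qChain_wpoly {n : ℕ} (hn : 1 ≤ n) (q : ℂ) {hs : List ℕ} (hhs : hs.Pairwise (· ≤ ·)) :
    QChain n (scaleVar q n (wpoly n q hs))
      (MvPolynomial.C (q ^ hs.count n) * wpoly n q hs) := by
  refine ⟨fun k => wsum n q hs fun us => q ^ us.countP (Finset.Icc k n ⊆ ·), ?_, ?_, ?_⟩
  · apply MvPolynomial.rename_injective _ (rot n).injective
    rw [rename_scaleVar, rename_rot_of_symm fun i hi hin => rename_swap_wpoly q hi hin hhs,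
      show rot n n = 1 by rw [rot_apply hn, if_pos rfl], wpoly, ← rename_rot_wsum hn q hhs]
    simp
  · rw [wpoly, ← wsum_const_mul]
    exact wsum_congr hhs fun us hv => by rw [countP_full hv, mul_one]
  · intro k hk hkn
    obtain ⟨h1, h2⟩ := wsum_exchange q hk hkn hhs
    refine ⟨h1 _ ?_, ?_⟩
    · intro us _
      simp only
      congr 1
      rw [swapAct, List.countP_map]
      congr 1
      ext u
      simp only [Function.comp_apply, decide_eq_decide]
      have : ∀ v : Finset ℕ, Finset.Icc k n ⊆ v →
          Finset.Icc k n ⊆ colAct (Equiv.swap k (k + 1)) v := by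
        intro v hv a ha
        by_cases ha1 : a = k
        · rw [ha1, mem_colAct_swap_left]; exact hv (by rw [Finset.mem_Icc]; omega)
        by_cases ha2 : a = k + 1
        · rw [ha2, mem_colAct_swap_right]; exact hv (by rw [Finset.mem_Icc]; omega)
        · rw [mem_colAct_swap_of_ne ha1 ha2]; exact hv ha
      refine ⟨fun h => ?_, this u⟩
      rw [← colAct_swap_swap k u]
      exact this _ h
    · simp only
      rw [← wsum_sub]
      refine (h2 _ fun us _ hus => ?_).symm
      rw [sub_eq_zero]
      congr 1
      refine List.countP_congr fun u hu => ?_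
      simp only [decide_eq_true_eq]
      constructor
      · intro h a ha
        by_cases ha1 : a = k
        · rw [ha1]; exact hus u hu (h (by rw [Finset.mem_Icc]; omega))
        · exact h (by rw [Finset.mem_Icc] at ha ⊢; omega)
      · intro h a ha
        exact h (by rw [Finset.mem_Icc] at ha ⊢; omega)

lemma X_dvd_scaleVar_sub (q : ℂ) (m : ℕ) (p : MvPolynomial ℕ ℂ) :
    MvPolynomial.X m ∣ scaleVar q m p - p := by
  induction p using MvPolynomial.induction_on with
  | C a => simp
  | add p r hp hr =>
    rw [map_add, add_sub_add_comm]
    exact dvd_add hp hr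
  | mul_X p a hp =>
    rw [map_mul, scaleVar_X]
    split_ifs with h
    · subst h
      rw [← mul_assoc, ← sub_mul]
      exact dvd_mul_left _ _
    · rw [← sub_mul]
      exact dvd_mul_of_dvd_left hp _

lemma X_dvd_of_eval_eq_zero {m : ℕ} {p : MvPolynomial ℕ ℂ}
    (h : ∀ x : ℕ → ℂ, x m = 0 → MvPolynomial.eval x p = 0) : MvPolynomial.X m ∣ p := by
  have h0 : scaleVar 0 m p = 0 := by
    apply MvPolynomial.funext
    intro x
    have : (MvPolynomial.eval x).comp (scaleVar 0 m : MvPolynomial ℕ ℂ →+* MvPolynomial ℕ ℂ)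
        = MvPolynomial.eval (Function.update x m 0) := by
      apply MvPolynomial.ringHom_ext
      · intro r; simp
      · intro a
        simp only [RingHom.comp_apply, RingHom.coe_coe, scaleVar_X, MvPolynomial.eval_X]
        by_cases ha : a = m
        · subst ha; simp
        · simp [ha]
    have h1 := congrArg (fun f => f p) this
    simp only [RingHom.comp_apply, RingHom.coe_coe] at h1
    rw [h1, map_zero]
    exact h _ (by simp)
  have := X_dvd_scaleVar_sub 0 m p
  rwa [h0, zero_sub, dvd_neg] at this

section QChain

variable {n : ℕ} {G F G' F' : MvPolynomial ℕ ℂ}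

lemma QChain.sub (h : QChain n G F) (h' : QChain n G' F') : QChain n (G - G') (F - F') := by
  obtain ⟨g, h1, h2, h3⟩ := h
  obtain ⟨g', h1', h2', h3'⟩ := h'
  refine ⟨fun k => g k - g' k, by simp only [h1, h1'], by simp only [h2, h2'], fun k hk hkn => ?_⟩
  obtain ⟨a1, a2⟩ := h3 k hk hkn
  obtain ⟨b1, b2⟩ := h3' k hk hkn
  refine ⟨by simp only [map_sub, a1, b1], ?_⟩
  simp only [map_sub] at a2 b2 ⊢
  linear_combination a2 - b2

lemma QChain.sum {ι : Type*} (s : Finset ι) {G F : ι → MvPolynomial ℕ ℂ}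
    (h : ∀ i ∈ s, QChain n (G i) (F i)) : QChain n (∑ i ∈ s, G i) (∑ i ∈ s, F i) := by
  choose! g h1 h2 h3 using h
  refine ⟨fun k => ∑ i ∈ s, g i k, Finset.sum_congr rfl h1, Finset.sum_congr rfl h2,
    fun k hk hkn => ⟨?_, ?_⟩⟩
  · rw [map_sum]
    exact Finset.sum_congr rfl fun i hi => (h3 i hi k hk hkn).1
  · rw [← Finset.sum_sub_distrib, map_sum, Finset.mul_sum, Finset.mul_sum]
    exact Finset.sum_congr rfl fun i hi => (h3 i hi k hk hkn).2

lemma QChain.mul_of_symm (h : QChain n G F) {r : MvPolynomial ℕ ℂ}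
    (hr : ∀ k, 1 ≤ k → k < n → MvPolynomial.rename (Equiv.swap k (k + 1)) r = r) :
    QChain n (r * G) (r * F) := by
  obtain ⟨g, h1, h2, h3⟩ := h
  refine ⟨fun k => r * g k, by simp only [h1], by simp only [h2], fun k hk hkn => ?_⟩
  obtain ⟨a1, a2⟩ := h3 k hk hkn
  refine ⟨by simp only [map_mul, a1, hr k hk hkn], ?_⟩
  rw [← mul_sub, map_mul, hr k hk hkn]
  linear_combination r * a2

end QChain

open MvPolynomial in
theorem eq_zero_of_qChain {n : ℕ} (hn : 1 ≤ n) {q : ℂ} (hq : ∀ e, 1 ≤ e → q ^ e ≠ 1)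
    {F : MvPolynomial ℕ ℂ}
    (hF : ∀ i, 1 ≤ i → i < n → rename (Equiv.swap i (i + 1)) F = F)
    (hc : QChain n (scaleVar q n F) F) (hd : X n ∣ F) : F = 0 := by
  obtain ⟨g, hgn, hg1, hg⟩ := hc
  have hprime : Prime (X n : MvPolynomial ℕ ℂ) := X_prime
  have key : ∀ e, 1 ≤ e → X n ^ e ∣ F := by
    intro e he
    induction e, he using Nat.le_induction with
    | base => simpa using hd
    | succ e he ih =>
      have hdn : X n ^ (e + 1) ∣ g n - C (q ^ e) * F := by
        obtain ⟨H, hH⟩ := ih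
        have : g n - C (q ^ e) * F = X n ^ e * (C (q ^ e) * (scaleVar q n H - H)) := by
          rw [hgn, hH, map_mul, map_pow, scaleVar_X, if_pos rfl, map_pow]
          ring
        rw [this, pow_succ]
        exact mul_dvd_mul_left _ (dvd_mul_of_dvd_right (X_dvd_scaleVar_sub q n H) _)
      have hall : ∀ j, j ≤ n - 1 → X n ^ (e + 1) ∣ g (n - j) - C (q ^ e) * F := by
        intro j
        induction j with
        | zero => intro _; simpa using hdn
        | succ j ihj =>
          intro hj
          obtain ⟨k, hk1, hkn, hk, hk'⟩ : ∃ k, 1 ≤ k ∧ k < n ∧ n - (j + 1) = k ∧ n - j = k + 1 :=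
            ⟨n - (j + 1), by omega, by omega, rfl, by omega⟩
          have ihk := ihj (by omega)
          rw [hk'] at ihk
          rw [hk]
          obtain ⟨s1, s2⟩ := hg k hk1 hkn
          have hS := hF k hk1 hkn
          have hrel : (X k - X (k + 1)) * (g k - C (q ^ e) * F)
              = X k * (g (k + 1) - C (q ^ e) * F)
                - X (k + 1) * rename (Equiv.swap k (k + 1)) (g (k + 1) - C (q ^ e) * F) := by
            simp only [map_sub, map_mul, s1, hS, rename_C] at s2 ⊢
            linear_combination -s2
          have hS2 : X n ^ (e + 1) ∣
              X (k + 1) * rename (Equiv.swap k (k + 1)) (g (k + 1) - C (q ^ e) * F) := by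
            by_cases hkn' : k + 1 = n
            · rw [hkn', pow_succ']
              refine mul_dvd_mul_left _ ?_
              have h1 : X k ^ e ∣ F := by
                have := map_dvd (rename (Equiv.swap k (k + 1))) ih
                rwa [hS, map_pow, rename_X, ← hkn', Equiv.swap_apply_right] at this
              have h2 : X k ^ e ∣ g n - C (q ^ e) * F := by
                refine dvd_sub ?_ (dvd_mul_of_dvd_right h1 _)
                have := map_dvd (scaleVar q n) h1
                rwa [map_pow, scaleVar_X, if_neg (by omega), ← hgn] at this
              have := map_dvd (rename (Equiv.swap k n)) h2
              rwa [map_pow, rename_X, Equiv.swap_apply_left] at this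
            · refine dvd_mul_of_dvd_right ?_ _
              have := map_dvd (rename (Equiv.swap k (k + 1))) ihk
              rwa [map_pow, rename_X,
                Equiv.swap_apply_of_ne_of_ne (by omega) (by omega)] at this
          have hdiv : X n ^ (e + 1) ∣ (X k - X (k + 1)) * (g k - C (q ^ e) * F) := by
            rw [hrel]
            exact dvd_sub (dvd_mul_of_dvd_right ihk _) hS2
          refine hprime.pow_dvd_of_dvd_mul_left _ ?_ hdiv
          rintro ⟨r, hr⟩
          have := congrArg (eval fun a => if a = k then (1 : ℂ) else 0) hr
          simp only [map_sub, map_mul, eval_X] at this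
          rw [if_pos trivial, if_neg (by omega), if_neg (by omega)] at this
          norm_num at this
      have h1 := hall (n - 1) le_rfl
      rw [show n - (n - 1) = 1 by omega, hg1] at h1
      have h2 : F - C (q ^ e) * F = C (1 - q ^ e) * F := by
        rw [map_sub, map_one]; ring
      rw [h2] at h1
      have hu : IsUnit (C (1 - q ^ e) : MvPolynomial ℕ ℂ) :=
        (IsUnit.mk0 _ (sub_ne_zero.2 (hq e he).symm)).map C
      exact (hu.dvd_mul_left).1 h1
  by_contra hF0
  obtain ⟨m, hm⟩ := FiniteMultiplicity.of_not_isUnit hprime.not_isUnit hF0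
  exact hm (key (m + 1) (by omega))

lemma wsum_concat_full (n : ℕ) (q : ℂ) (hs : List ℕ) (φ : List (Finset ℕ) → ℂ) :
    wsum n q (hs ++ [n]) φ = (∏ a ∈ Finset.Icc 1 n, MvPolynomial.X a) *
      wsum n q hs (fun us => φ (us ++ [Finset.Icc 1 n])) := by
  induction hs generalizing φ with
  | nil =>
    have h : (Finset.Icc 1 n).powersetCard n = {Finset.Icc 1 n} := by
      have := Finset.powersetCard_self (Finset.Icc 1 n)
      rwa [Nat.card_Icc, Nat.add_sub_cancel] at this
    simp [wsum, h, carry, carryE]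
  | cons h hs ih =>
    rw [List.cons_append, wsum, wsum, Finset.mul_sum]
    refine Finset.sum_congr rfl fun c hc => ?_
    have hc' := (Finset.mem_powersetCard.1 hc).1
    rw [ih, mul_left_comm]
    simp only [carryE, carry, List.map_append, List.map_cons, List.map_nil, List.sum_append,
      Hloc_full hc', Rright_full hc', List.sum_cons, List.sum_nil, add_zero, List.cons_append]

lemma wpoly_concat_full (n : ℕ) (q : ℂ) (hs : List ℕ) :
    wpoly n q (hs ++ [n]) = (∏ a ∈ Finset.Icc 1 n, MvPolynomial.X a) * wpoly n q hs :=
  wsum_concat_full n q hs _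

lemma wsum_eq_zero_of_lt {n : ℕ} (q : ℂ) {hs : List ℕ} {k : ℕ} (hk : k ∈ hs) (hn : n < k)
    (φ : List (Finset ℕ) → ℂ) : wsum n q hs φ = 0 := by
  induction hs generalizing φ with
  | nil => simp at hk
  | cons h hs ih =>
    rw [wsum]
    rcases List.mem_cons.1 hk with rfl | hk
    · rw [Finset.powersetCard_eq_empty.2 (by simpa using hn), Finset.sum_empty]
    · exact Finset.sum_eq_zero fun c _ => by rw [ih hk, mul_zero]

lemma colPairWord_of_subset {n : ℕ} {u c : Finset ℕ} (hu : u ⊆ Finset.Icc 1 n)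
    (hc : c ⊆ Finset.Icc 1 n) : colPairWord (n + 1) u c = colPairWord n u c := by
  have h : ∀ v ⊆ Finset.Icc 1 n, n + 1 ∉ v := fun v hv ha => by simpa using hv ha
  rw [colPairWord_succ, if_neg (h u hu), if_neg (h c hc)]
  simp

lemma eval_wsum_succ {n : ℕ} (q : ℂ) {x : ℕ → ℂ} (hx : x (n + 1) = 0) {hs : List ℕ}
    (hhs : hs.Pairwise (· ≤ ·)) {φ ψ : List (Finset ℕ) → ℂ}
    (h : ∀ us, ValidSt n hs us → φ us = ψ us) :
    MvPolynomial.eval x (wsum (n + 1) q hs φ) = MvPolynomial.eval x (wsum n q hs ψ) := by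
  induction hs generalizing φ ψ with
  | nil => simp only [wsum]; rw [h [] ⟨List.Forall₂.nil, List.Pairwise.nil⟩]
  | cons k hs ih =>
    rw [List.pairwise_cons] at hhs
    have hsub : (Finset.Icc 1 n).powersetCard k ⊆ (Finset.Icc 1 (n + 1)).powersetCard k :=
      Finset.powersetCard_mono (Finset.Icc_subset_Icc_right (by omega))
    rw [wsum, wsum, map_sum, map_sum, ← Finset.sum_subset hsub]
    · refine Finset.sum_congr rfl fun c hc => ?_
      rw [map_mul, map_mul]
      congr 1
      refine ih hhs.2 fun us hv => ?_
      have hc' := (Finset.mem_powersetCard.1 hc).1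
      have hA : ∀ u ∈ us, Adm n u c := fun u hu => hv.adm hhs.1 hc hu
      have h1 : carryE (n + 1) c us = carryE n c us := by
        rw [carryE, carryE]
        congr 1
        exact List.map_congr_left fun u hu => by
          rw [Hloc, Hloc, colPairWord_of_subset (hA u hu).left hc']
      have h2 : carry (n + 1) c us = carry n c us := by
        rw [carry, carry]
        congr 1
        exact List.map_congr_left fun u hu => by
          rw [Rright, Rright, colPairWord_of_subset (hA u hu).left hc']
      rw [h1, h2, h _ (hv.carry hhs.1 hc)]
    · intro c hc hc'
      have hmem : n + 1 ∈ c := by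
        by_contra hcon
        refine hc' (Finset.mem_powersetCard.2 ⟨fun a ha => ?_, (Finset.mem_powersetCard.1 hc).2⟩)
        have h1 := (Finset.mem_powersetCard.1 hc).1 ha
        have h2 : a ≠ n + 1 := fun h => hcon (h ▸ ha)
        rw [Finset.mem_Icc] at h1 ⊢
        omega
      rw [map_mul, map_prod, Finset.prod_eq_zero hmem (by simp [hx]), zero_mul]

lemma eval_wpoly_succ {n : ℕ} (q : ℂ) {x : ℕ → ℂ} (hx : x (n + 1) = 0) {hs : List ℕ}
    (hhs : hs.Pairwise (· ≤ ·)) :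
    MvPolynomial.eval x (wpoly (n + 1) q hs) = MvPolynomial.eval x (wpoly n q hs) :=
  eval_wsum_succ q hx hhs fun _ _ => rfl

section PowerChain

open MvPolynomial

/-- The geometric series `∑ aᵐ uᵐ`. -/
noncomputable def geomSeries {B : Type*} [CommRing B] (a : B) : PowerSeries B :=
  PowerSeries.mk fun m => a ^ m

lemma one_sub_mul_geomSeries {B : Type*} [CommRing B] (a : B) :
    (1 - PowerSeries.C a * PowerSeries.X) * geomSeries a = 1 := by
  ext m
  rw [sub_mul, one_mul, map_sub, mul_assoc, PowerSeries.coeff_C_mul]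
  cases m with
  | zero => simp [geomSeries]
  | succ m =>
    rw [PowerSeries.coeff_succ_X_mul]
    simp [geomSeries, PowerSeries.coeff_one, pow_succ']

lemma map_geomSeries {B D : Type*} [CommRing B] [CommRing D] (f : B →+* D) (a : B) :
    PowerSeries.map f (geomSeries a) = geomSeries (f a) := by
  ext m; simp [geomSeries]

lemma prod_Icc_swap {M : Type*} [CommMonoid M] {k n : ℕ} {l : ℕ} (hl : l ≤ k) (hkn : k < n)
    (f : ℕ → M) :
    ∏ i ∈ Finset.Icc l n, f (Equiv.swap k (k + 1) i) = ∏ i ∈ Finset.Icc l n, f i := by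
  refine Finset.prod_equiv (Equiv.swap k (k + 1)) (fun i => ?_) fun _ _ => rfl
  rw [Finset.mem_Icc, Finset.mem_Icc, Equiv.swap_apply_def]
  split_ifs <;> omega

/-- The generating series interpolating between the powers of `X n` and symmetric polynomials. -/
noncomputable def powSeries (n k : ℕ) : PowerSeries (MvPolynomial ℕ ℂ) :=
  (-1) ^ (n - k) * (PowerSeries.X ^ (n - k + 1) *
    ∏ i ∈ Finset.Icc k n, (PowerSeries.C (X i) * geomSeries (X i)))

lemma map_swap_prod {n k : ℕ} (hkn : k < n) :
    PowerSeries.map (rename (R := ℂ) (Equiv.swap k (k + 1))).toRingHom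
      (∏ i ∈ Finset.Icc k n, (PowerSeries.C (X i) * geomSeries (X i)))
      = ∏ i ∈ Finset.Icc k n, (PowerSeries.C (X i) * geomSeries (X i)) := by
  rw [map_prod, ← prod_Icc_swap le_rfl hkn]
  refine Finset.prod_congr rfl fun i _ => ?_
  simp [map_geomSeries]

lemma powSeries_sub {n k : ℕ} (hkn : k < n) :
    PowerSeries.C (X k) * (powSeries n (k + 1) - powSeries n k) =
      (-1) ^ (n - k - 1) * (PowerSeries.X ^ (n - k) *
        ∏ i ∈ Finset.Icc k n, (PowerSeries.C (X i) * geomSeries (X i))) := by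
  obtain ⟨e, rfl⟩ : ∃ e, n = k + 1 + e := ⟨n - (k + 1), by omega⟩
  rw [powSeries, powSeries, ← Finset.mul_prod_Ioc_eq_prod_Icc (by omega : k ≤ k + 1 + e)]
  rw [show Finset.Ioc k (k + 1 + e) = Finset.Icc (k + 1) (k + 1 + e) by ext; simp]
  rw [show k + 1 + e - (k + 1) = e by omega, show k + 1 + e - k = e + 1 by omega]
  have h := one_sub_mul_geomSeries (X k : MvPolynomial ℕ ℂ)
  rw [Nat.add_sub_cancel]
  linear_combination (- (-1) ^ e * PowerSeries.X ^ (e + 1) * PowerSeries.C (X k) *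
    ∏ i ∈ Finset.Icc (k + 1) (k + 1 + e), (PowerSeries.C (X i) * geomSeries (X i))) * h

lemma qChain_X_pow {n m : ℕ} (hm : 1 ≤ m) :
    QChain n (X n ^ m) (PowerSeries.coeff m (powSeries n 1)) := by
  refine ⟨fun k => PowerSeries.coeff m (powSeries n k), ?_, rfl, fun k hk hkn => ⟨?_, ?_⟩⟩
  · obtain ⟨m, rfl⟩ : ∃ m', m = m' + 1 := ⟨m - 1, by omega⟩
    simp [powSeries, geomSeries, PowerSeries.coeff_succ_X_mul, pow_succ']
  · have : PowerSeries.map (rename (R := ℂ) (Equiv.swap k (k + 1))).toRingHom (powSeries n k)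
        = powSeries n k := by
      rw [powSeries, map_mul, map_mul, map_swap_prod hkn]
      simp
    exact congrArg (PowerSeries.coeff m) this
  · have h1 := powSeries_sub hkn
    have h2 := congrArg
      (PowerSeries.map (rename (R := ℂ) (Equiv.swap k (k + 1))).toRingHom) h1
    rw [map_mul, map_mul, map_mul, map_swap_prod hkn] at h2
    simp only [map_pow, map_neg, map_one, PowerSeries.map_X] at h2
    rw [← h1] at h2
    have h3 := congrArg (PowerSeries.coeff m) h2
    simpa using h3.symm

lemma coeff_powSeries_of_lt {n m : ℕ} (hn : 1 ≤ n) (hm : m < n) :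
    PowerSeries.coeff m (powSeries n 1) = 0 := by
  rw [powSeries, mul_left_comm, Nat.sub_add_cancel hn, PowerSeries.coeff_X_pow_mul',
    if_neg (by omega)]

lemma coeff_powSeries_self {n : ℕ} (hn : 1 ≤ n) :
    PowerSeries.coeff n (powSeries n 1) = (-1) ^ (n - 1) * ∏ i ∈ Finset.Icc 1 n, X i := by
  rw [powSeries, mul_left_comm, Nat.sub_add_cancel hn, PowerSeries.coeff_X_pow_mul',
    if_pos le_rfl, Nat.sub_self, PowerSeries.coeff_zero_eq_constantCoeff_apply]
  simp [geomSeries, map_prod]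

lemma qChain_one (n : ℕ) : QChain n 1 1 := ⟨fun _ => 1, rfl, rfl, fun k _ _ => by simp⟩

end PowerChain

lemma qPoch_zero (p : ℂ) : qPoch p 0 = 1 := by simp [qPoch]

lemma qPoch_succ (p : ℂ) (m : ℕ) : qPoch p (m + 1) = qPoch p m * (1 - p ^ (m + 1)) := by
  rw [qPoch, qPoch, Finset.prod_range_succ]

lemma qPoch_ne_zero {q : ℂ} (hq : ∀ e, 1 ≤ e → q ^ e ≠ 1) (m : ℕ) : qPoch q m ≠ 0 :=
  Finset.prod_ne_zero_iff.2 fun j _ => sub_ne_zero.2 (hq (j + 1) (by omega)).symm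

section Euler

variable {B D : Type*} [CommRing B] [Algebra ℂ B] [CommRing D] [Algebra ℂ D]

/-- The series `∑ aᵐ sᵐ / (q;q)_m`. -/
noncomputable def eulerSeries (q : ℂ) (a : B) : PowerSeries B :=
  PowerSeries.mk fun m => algebraMap ℂ B (qPoch q m)⁻¹ * a ^ m

lemma map_eulerSeries (f : B →ₐ[ℂ] D) (q : ℂ) (a : B) :
    PowerSeries.map (f : B →+* D) (eulerSeries q a) = eulerSeries q (f a) := by
  ext m
  simp [eulerSeries]

lemma eulerSeries_zero (q : ℂ) : eulerSeries q (0 : B) = 1 := by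
  ext m
  rw [eulerSeries, PowerSeries.coeff_mk, PowerSeries.coeff_one]
  split_ifs with h
  · simp [h, qPoch_zero]
  · simp [h]

lemma eulerSeries_mul {q : ℂ} (hq : ∀ e, 1 ≤ e → q ^ e ≠ 1) (a : B) :
    eulerSeries q (algebraMap ℂ B q * a)
      = eulerSeries q a * (1 - PowerSeries.C a * PowerSeries.X) := by
  ext m
  rw [mul_comm (eulerSeries q a), sub_mul, one_mul, map_sub, mul_assoc, PowerSeries.coeff_C_mul]
  cases m with
  | zero => simp [eulerSeries]
  | succ m =>
    rw [PowerSeries.coeff_succ_X_mul]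
    simp only [eulerSeries, PowerSeries.coeff_mk]
    have h1 : (qPoch q m)⁻¹ = (qPoch q (m + 1))⁻¹ * (1 - q ^ (m + 1)) := by
      have h2 := qPoch_ne_zero hq (m + 1)
      have h3 := qPoch_ne_zero hq m
      rw [qPoch_succ] at h2 ⊢
      field_simp [right_ne_zero_of_mul h2]
    rw [h1, map_mul, map_sub, map_one, map_pow]
    ring

/-- The generating series of the degree components of the Cauchy kernel. -/
noncomputable def kernelSeries (n : ℕ) (q : ℂ) (x y : ℕ → B) : PowerSeries B :=
  ∏ i ∈ Finset.Icc 1 n, ∏ j ∈ Finset.Icc 1 n, eulerSeries q (x i * y j)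

lemma map_kernelSeries (f : B →ₐ[ℂ] D) (n : ℕ) (q : ℂ) (x y : ℕ → B) :
    PowerSeries.map (f : B →+* D) (kernelSeries n q x y)
      = kernelSeries n q (fun i => f (x i)) (fun j => f (y j)) := by
  simp only [kernelSeries, map_prod, map_eulerSeries, map_mul]

lemma kernelSeries_comm (n : ℕ) (q : ℂ) (x y : ℕ → B) :
    kernelSeries n q x y = kernelSeries n q y x := by
  rw [kernelSeries, Finset.prod_comm, kernelSeries]
  simp only [mul_comm]

lemma kernelSeries_succ {n : ℕ} (q : ℂ) {x y : ℕ → B} (hx : x (n + 1) = 0) (hy : y (n + 1) = 0) :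
    kernelSeries (n + 1) q x y = kernelSeries n q x y := by
  simp only [kernelSeries]
  rw [Finset.prod_Icc_succ_top (by omega)]
  simp only [Finset.prod_Icc_succ_top (show 1 ≤ n + 1 by omega), hx, hy, zero_mul, mul_zero,
    eulerSeries_zero, Finset.prod_const_one, mul_one]

end Euler

section Kernel

open MvPolynomial

/-- The polynomial `∏ j, (1 - y_j s)`. -/
noncomputable def linProd (n : ℕ) (y : ℕ → ℂ) : Polynomial ℂ :=
  ∏ j ∈ Finset.Icc 1 n, (1 - Polynomial.C (y j) * Polynomial.X)

lemma natDegree_one_sub_C_mul_X_le (a : ℂ) :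
    (1 - Polynomial.C a * Polynomial.X).natDegree ≤ 1 := by
  compute_degree

lemma coeff_linProd_zero (n : ℕ) (y : ℕ → ℂ) : (linProd n y).coeff 0 = 1 := by
  rw [Polynomial.coeff_zero_eq_eval_zero, linProd, Polynomial.eval_prod]
  simp

lemma coeff_linProd_self (n : ℕ) (y : ℕ → ℂ) :
    (linProd n y).coeff n = (-1) ^ n * ∏ j ∈ Finset.Icc 1 n, y j := by
  have := Polynomial.coeff_prod_of_natDegree_le (Finset.Icc 1 n)
    (fun j => 1 - Polynomial.C (y j) * Polynomial.X) 1
    fun j _ => natDegree_one_sub_C_mul_X_le (y j)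
  rw [Nat.card_Icc, Nat.add_sub_cancel, mul_one] at this
  rw [linProd, this]
  simp [Polynomial.coeff_one, Finset.prod_neg]

lemma coeff_linProd_of_lt {n m : ℕ} (h : n < m) (y : ℕ → ℂ) : (linProd n y).coeff m = 0 := by
  apply Polynomial.coeff_eq_zero_of_natDegree_lt
  refine lt_of_le_of_lt (Polynomial.natDegree_prod_le _ _) ?_
  refine lt_of_le_of_lt (Finset.sum_le_card_nsmul _ _ 1
    fun j _ => natDegree_one_sub_C_mul_X_le (y j)) ?_
  simpa using h

/-- The degree components of the Cauchy kernel, as polynomials in `x`. -/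
noncomputable def kpoly (n : ℕ) (q : ℂ) (y : ℕ → ℂ) (d : ℕ) : MvPolynomial ℕ ℂ :=
  PowerSeries.coeff d (kernelSeries n q X fun j => C (y j))

lemma eval_kpoly (n : ℕ) (q : ℂ) (x y : ℕ → ℂ) (d : ℕ) :
    eval x (kpoly n q y d) = PowerSeries.coeff d (kernelSeries n q x y) := by
  have h := map_kernelSeries (MvPolynomial.aeval x : MvPolynomial ℕ ℂ →ₐ[ℂ] ℂ) n q X
    fun j => C (y j)
  have h2 := congrArg (PowerSeries.coeff d) h
  simpa [kpoly] using h2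

lemma rename_swap_kpoly {n k : ℕ} (hk : 1 ≤ k) (hkn : k < n) (q : ℂ) (y : ℕ → ℂ) (d : ℕ) :
    rename (Equiv.swap k (k + 1)) (kpoly n q y d) = kpoly n q y d := by
  have h := map_kernelSeries (rename (R := ℂ) (Equiv.swap k (k + 1))) n q X fun j => C (y j)
  have h1 := congrArg (PowerSeries.coeff d) h
  simp only [rename_X, rename_C] at h1
  rw [show kernelSeries n q (fun i => (X (Equiv.swap k (k + 1) i) : MvPolynomial ℕ ℂ))
      (fun j => C (y j)) = kernelSeries n q X fun j => C (y j) from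
    prod_Icc_swap hk hkn fun i =>
      ∏ j ∈ Finset.Icc 1 n, eulerSeries q ((X i : MvPolynomial ℕ ℂ) * C (y j))] at h1
  simpa [kpoly] using h1

lemma prod_one_sub_eq_mk (n : ℕ) (y : ℕ → ℂ) (a : MvPolynomial ℕ ℂ) :
    ∏ j ∈ Finset.Icc 1 n, (1 - PowerSeries.C (a * C (y j)) * PowerSeries.X)
      = PowerSeries.mk fun m => C ((linProd n y).coeff m) * a ^ m := by
  have h : ∏ j ∈ Finset.Icc 1 n, (1 - PowerSeries.C (a * C (y j)) * PowerSeries.X)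
      = PowerSeries.rescale a (PowerSeries.map C (linProd n y : PowerSeries ℂ)) := by
    rw [linProd, ← Polynomial.coeToPowerSeries.ringHom_apply, map_prod, map_prod, map_prod]
    refine Finset.prod_congr rfl fun j _ => ?_
    have hc : PowerSeries.rescale a (PowerSeries.C (C (y j))) = PowerSeries.C (C (y j)) := by
      ext1 m
      rw [PowerSeries.coeff_rescale, PowerSeries.coeff_C]
      split_ifs with h
      · simp [h]
      · simp
    simp [PowerSeries.rescale_X, hc]
    ring
  rw [h]
  ext1 m
  simp [PowerSeries.coeff_rescale, mul_comm]

lemma scaleVar_kpoly {n : ℕ} (hn : 1 ≤ n) {q : ℂ} (hq : ∀ e, 1 ≤ e → q ^ e ≠ 1) (y : ℕ → ℂ)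
    (d : ℕ) : scaleVar q n (kpoly n q y d) = ∑ p ∈ Finset.HasAntidiagonal.antidiagonal d,
      kpoly n q y p.1 * (C ((linProd n y).coeff p.2) * X n ^ p.2) := by
  have h := map_kernelSeries (scaleVar q n) n q X fun j => C (y j)
  have h1 := congrArg (PowerSeries.coeff d) h
  rw [PowerSeries.coeff_map] at h1
  refine h1.trans ?_
  have hx : ∀ j, eulerSeries q (scaleVar q n (X n) * scaleVar q n (C (y j)))
      = eulerSeries q ((X n : MvPolynomial ℕ ℂ) * C (y j)) *
        (1 - PowerSeries.C (X n * C (y j)) * PowerSeries.X) := by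
    intro j
    rw [scaleVar_X, if_pos rfl, scaleVar_C, mul_assoc, ← MvPolynomial.algebraMap_eq,
      eulerSeries_mul hq]
  have hx' : ∀ i ∈ (Finset.Icc 1 n).erase n, ∏ j ∈ Finset.Icc 1 n,
      eulerSeries q (scaleVar q n (X i) * scaleVar q n (C (y j)))
      = ∏ j ∈ Finset.Icc 1 n, eulerSeries q ((X i : MvPolynomial ℕ ℂ) * C (y j)) := by
    intro i hi
    refine Finset.prod_congr rfl fun j _ => ?_
    rw [scaleVar_X, if_neg (Finset.ne_of_mem_erase hi), scaleVar_C]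
  have h2 : kernelSeries n q (fun i => scaleVar q n (X i)) (fun j => scaleVar q n (C (y j)))
      = kernelSeries n q X (fun j => C (y j)) *
        ∏ j ∈ Finset.Icc 1 n, (1 - PowerSeries.C (X n * C (y j)) * PowerSeries.X) := by
    have hmem : n ∈ Finset.Icc 1 n := Finset.mem_Icc.2 ⟨hn, le_rfl⟩
    rw [kernelSeries, kernelSeries, ← Finset.mul_prod_erase _ (fun i => ∏ j ∈ Finset.Icc 1 n,
      eulerSeries q (scaleVar q n (X i) * scaleVar q n (C (y j)))) hmem,
      ← Finset.mul_prod_erase _ (fun i => ∏ j ∈ Finset.Icc 1 n,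
      eulerSeries q ((X i : MvPolynomial ℕ ℂ) * C (y j))) hmem, mul_right_comm,
      ← Finset.prod_mul_distrib, Finset.prod_congr rfl hx',
      Finset.prod_congr rfl fun j _ => hx j]
  rw [h2, prod_one_sub_eq_mk, PowerSeries.coeff_mul]
  refine Finset.sum_congr rfl fun p _ => ?_
  rw [PowerSeries.coeff_mk, kpoly]

lemma qChain_kpoly {n : ℕ} (hn : 1 ≤ n) {q : ℂ} (hq : ∀ e, 1 ≤ e → q ^ e ≠ 1) (y : ℕ → ℂ)
    (d : ℕ) : QChain n (scaleVar q n (kpoly n q y d)) (kpoly n q y d -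
      if n ≤ d then C (∏ j ∈ Finset.Icc 1 n, y j) * (∏ i ∈ Finset.Icc 1 n, X i) *
        kpoly n q y (d - n) else 0) := by
  have hF : ∀ m, QChain n (C ((linProd n y).coeff m) * X n ^ m)
      (if m = 0 then 1 else if m = n then
        -(C (∏ j ∈ Finset.Icc 1 n, y j) * ∏ i ∈ Finset.Icc 1 n, X i) else 0) := by
    intro m
    rcases Nat.eq_zero_or_pos m with rfl | hm
    · simpa [coeff_linProd_zero] using qChain_one n
    rw [if_neg (by omega)]
    have h := (qChain_X_pow (n := n) hm).mul_of_symm (r := C ((linProd n y).coeff m))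
      fun k _ _ => rename_C _ _
    convert h using 1
    rcases lt_trichotomy m n with hmn | rfl | hmn
    · rw [if_neg (by omega), coeff_powSeries_of_lt hn hmn, mul_zero]
    · rw [if_pos rfl, coeff_powSeries_self hn, coeff_linProd_self]
      obtain ⟨e, rfl⟩ : ∃ e, m = e + 1 := ⟨m - 1, by omega⟩
      have : ((-1) ^ e * (-1) ^ e : MvPolynomial ℕ ℂ) = 1 := by
        rw [← mul_pow]; simp
      simp only [map_mul, map_pow, map_neg, map_one, Nat.add_sub_cancel]
      linear_combination (C (∏ j ∈ Finset.Icc 1 (e + 1), y j) *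
        ∏ i ∈ Finset.Icc 1 (e + 1), X i) * this
    · rw [if_neg (by omega), coeff_linProd_of_lt hmn]; simp
  have h := QChain.sum (n := n) (Finset.HasAntidiagonal.antidiagonal d) fun p _ =>
    (hF p.2).mul_of_symm (r := kpoly n q y p.1) fun k hk hkn => rename_swap_kpoly hk hkn q y p.1
  rw [scaleVar_kpoly hn hq]
  have hn0 : ¬ n = 0 := by omega
  convert h using 1
  have hs : ∀ p ∈ Finset.HasAntidiagonal.antidiagonal d, kpoly n q y p.1 * (if p.2 = 0 then 1
      else if p.2 = n then
        -(C (∏ j ∈ Finset.Icc 1 n, y j) * ∏ i ∈ Finset.Icc 1 n, X i) else 0)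
      = (if p = (d, 0) then kpoly n q y d else 0) - if p = (d - n, n) then
        C (∏ j ∈ Finset.Icc 1 n, y j) * (∏ i ∈ Finset.Icc 1 n, X i) * kpoly n q y (d - n)
        else 0 := by
    rintro ⟨a, b⟩ hp
    rw [Finset.HasAntidiagonal.mem_antidiagonal] at hp
    simp only [Prod.mk.injEq] at hp ⊢
    by_cases hb : b = 0
    · rw [if_pos hb, if_pos ⟨by omega, hb⟩, if_neg (by omega), mul_one, sub_zero,
        show a = d by omega]
    · rw [if_neg hb, if_neg (c := a = d ∧ b = 0) (by tauto)]
      by_cases hbn : b = n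
      · rw [if_pos hbn, if_pos ⟨by omega, hbn⟩, show a = d - n by omega]
        ring
      · rw [if_neg hbn, if_neg (c := a = d - n ∧ b = n) (by tauto)]
        ring
  rw [Finset.sum_congr rfl hs, Finset.sum_sub_distrib, Finset.sum_ite_eq', Finset.sum_ite_eq',
    if_pos (Finset.HasAntidiagonal.mem_antidiagonal.2 (add_zero d))]
  congr 1
  refine if_congr ?_ rfl rfl
  rw [Finset.HasAntidiagonal.mem_antidiagonal]
  exact ⟨fun h => by omega, fun h => by omega⟩

/-- `∏ 1/(q;q)_{mᵢ}` over the multiplicities of a multiset. -/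
noncomputable def bMult (q : ℂ) (s : Multiset ℕ) : ℂ :=
  ∏ i ∈ s.toFinset, (qPoch q (s.count i))⁻¹

lemma bMult_eq_prod (q : ℂ) {s : Multiset ℕ} {S : Finset ℕ} (h : s.toFinset ⊆ S) :
    bMult q s = ∏ i ∈ S, (qPoch q (s.count i))⁻¹ := by
  refine Finset.prod_subset h fun i _ hi => ?_
  rw [Multiset.count_eq_zero_of_notMem (by simpa using hi), qPoch_zero, inv_one]

lemma bMult_cons {q : ℂ} (hq : ∀ e, 1 ≤ e → q ^ e ≠ 1) (n : ℕ) (s : Multiset ℕ) :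
    bMult q (n ::ₘ s) * (1 - q ^ (n ::ₘ s).count n) = bMult q s := by
  have hn : n ∈ insert n s.toFinset := Finset.mem_insert_self _ _
  rw [bMult_eq_prod q (s := n ::ₘ s) (S := insert n s.toFinset) (by simp),
    bMult_eq_prod q (s := s) (Finset.subset_insert n _),
    ← Finset.mul_prod_erase _ _ hn, ← Finset.mul_prod_erase _ _ hn, Multiset.count_cons_self,
    qPoch_succ]
  have h1 : (1 - q ^ (s.count n + 1)) ≠ 0 := sub_ne_zero.2 (hq _ (by omega)).symm
  rw [Finset.prod_congr rfl fun i hi => by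
    rw [Multiset.count_cons_of_ne (Finset.ne_of_mem_erase hi)]]
  have h2 := qPoch_ne_zero hq (s.count n)
  field_simp

/-- The `q`-Whittaker polynomial attached to the multiset of its column heights. -/
noncomputable def mpoly (n : ℕ) (q : ℂ) (s : Multiset ℕ) : MvPolynomial ℕ ℂ :=
  wpoly n q (s.sort (· ≤ ·))

lemma mpoly_eq_zero {n : ℕ} (q : ℂ) {s : Multiset ℕ} {k : ℕ} (hk : k ∈ s) (hn : n < k) :
    mpoly n q s = 0 :=
  wsum_eq_zero_of_lt q ((Multiset.mem_sort (r := (· ≤ ·))).2 hk) hn _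

lemma mpoly_cons (n : ℕ) (q : ℂ) (s : Multiset ℕ) :
    mpoly n q (n ::ₘ s) = (∏ a ∈ Finset.Icc 1 n, X a) * mpoly n q s := by
  by_cases h : ∃ k ∈ s, n < k
  · obtain ⟨k, hk, hn⟩ := h
    rw [mpoly_eq_zero q (Multiset.mem_cons_of_mem hk) hn, mpoly_eq_zero q hk hn, mul_zero]
  · push Not at h
    rw [mpoly, mpoly, ← wpoly_concat_full]
    congr 1
    refine List.Perm.eq_of_pairwise (le := (· ≤ ·)) (fun a b _ _ => le_antisymm)
      (Multiset.pairwise_sort _ _) ?_ ?_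
    · rw [List.pairwise_append]
      refine ⟨Multiset.pairwise_sort _ _, by simp, fun a ha b hb => ?_⟩
      rw [List.mem_singleton] at hb
      rw [hb]
      exact h a ((Multiset.mem_sort (r := (· ≤ ·))).1 ha)
    · rw [← Multiset.coe_eq_coe, Multiset.sort_eq, ← Multiset.coe_add, Multiset.sort_eq]
      rw [add_comm]; rfl

lemma rename_swap_mpoly {n i : ℕ} (q : ℂ) (hi : 1 ≤ i) (hin : i < n) (s : Multiset ℕ) :
    rename (Equiv.swap i (i + 1)) (mpoly n q s) = mpoly n q s :=
  rename_swap_wpoly q hi hin (Multiset.pairwise_sort _ _)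

lemma qChain_mpoly {n : ℕ} (hn : 1 ≤ n) (q : ℂ) (s : Multiset ℕ) :
    QChain n (scaleVar q n (mpoly n q s)) (C (q ^ s.count n) * mpoly n q s) := by
  have := qChain_wpoly hn q (Multiset.pairwise_sort s (· ≤ ·))
  rwa [← Multiset.coe_count, Multiset.sort_eq] at this

lemma eval_mpoly_succ {n : ℕ} (q : ℂ) {x : ℕ → ℂ} (hx : x (n + 1) = 0) (s : Multiset ℕ) :
    eval x (mpoly (n + 1) q s) = eval x (mpoly n q s) :=
  eval_wpoly_succ q hx (Multiset.pairwise_sort _ _)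

/-- The degree components of the left-hand side of the Cauchy identity. -/
noncomputable def zpoly (n : ℕ) (q : ℂ) (y : ℕ → ℂ) (d : ℕ) : MvPolynomial ℕ ℂ :=
  ∑ p : Nat.Partition d, C (bMult q p.parts * eval y (mpoly n q p.parts)) * mpoly n q p.parts

lemma eval_zpoly (n : ℕ) (q : ℂ) (x y : ℕ → ℂ) (d : ℕ) : eval x (zpoly n q y d)
    = ∑ p : Nat.Partition d,
      bMult q p.parts * eval y (mpoly n q p.parts) * eval x (mpoly n q p.parts) := by
  simp [zpoly]

lemma rename_swap_zpoly {n k : ℕ} (hk : 1 ≤ k) (hkn : k < n) (q : ℂ) (y : ℕ → ℂ) (d : ℕ) :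
    rename (Equiv.swap k (k + 1)) (zpoly n q y d) = zpoly n q y d := by
  rw [zpoly, map_sum]
  refine Finset.sum_congr rfl fun p _ => ?_
  rw [map_mul, rename_C, rename_swap_mpoly q hk hkn]

/-- Adding a part to a partition. -/
def consPart {n d : ℕ} (hn : 1 ≤ n) (hd : n ≤ d) (p : Nat.Partition (d - n)) :
    Nat.Partition d where
  parts := n ::ₘ p.parts
  parts_pos {i} hi := by
    rcases Multiset.mem_cons.1 hi with rfl | hi
    · exact hn
    · exact p.parts_pos hi
  parts_sum := by rw [Multiset.sum_cons, p.parts_sum]; omega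

lemma qChain_zpoly {n : ℕ} (hn : 1 ≤ n) {q : ℂ} (hq : ∀ e, 1 ≤ e → q ^ e ≠ 1) (y : ℕ → ℂ)
    (d : ℕ) : QChain n (scaleVar q n (zpoly n q y d)) (zpoly n q y d -
      if n ≤ d then C (∏ j ∈ Finset.Icc 1 n, y j) * (∏ i ∈ Finset.Icc 1 n, X i) *
        zpoly n q y (d - n) else 0) := by
  have h := QChain.sum (n := n) (Finset.univ : Finset (Nat.Partition d)) fun p _ =>
    (qChain_mpoly hn q p.parts).mul_of_symm
      (r := C (bMult q p.parts * eval y (mpoly n q p.parts))) fun k _ _ => rename_C _ _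
  convert h using 1
  · rw [zpoly, map_sum]
    exact Finset.sum_congr rfl fun p _ => by rw [map_mul, scaleVar_C]
  rw [sub_eq_iff_eq_add', ← sub_eq_iff_eq_add, zpoly, ← Finset.sum_sub_distrib]
  split_ifs with hd
  · rw [zpoly, Finset.mul_sum]
    symm
    refine Finset.sum_of_injOn (consPart hn hd) (fun p _ p' _ h => ?_) (fun _ _ => by simp)
      (fun p _ hp => ?_) fun p _ => ?_
    · have := congrArg Nat.Partition.parts h
      exact Nat.Partition.ext (by simpa [consPart] using this)
    · have : n ∉ p.parts := by
        intro hmem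
        refine hp ⟨⟨p.parts.erase n, fun hi => p.parts_pos (Multiset.mem_of_mem_erase hi), ?_⟩,
          by simp, Nat.Partition.ext (Multiset.cons_erase hmem)⟩
        have h1 := congrArg Multiset.sum (Multiset.cons_erase hmem)
        rw [Multiset.sum_cons, p.parts_sum] at h1
        omega
      rw [Multiset.count_eq_zero_of_notMem this]
      simp
    · have h1 := bMult_cons hq n p.parts
      simp only [consPart]
      rw [mpoly_cons, map_mul, ← h1]
      simp only [map_mul, map_sub, map_prod, eval_X, map_one]
      ring
  · refine Finset.sum_eq_zero fun p _ => ?_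
    have : n ∉ p.parts := fun hmem => hd (p.parts_sum ▸ Multiset.le_sum_of_mem hmem)
    rw [Multiset.count_eq_zero_of_notMem this]
    simp

lemma zpoly_eq_kpoly_of_forall {n : ℕ} (hn : 1 ≤ n) {q : ℂ} (hq : ∀ e, 1 ≤ e → q ^ e ≠ 1)
    {y : ℕ → ℂ} (h : ∀ x : ℕ → ℂ, x n = 0 → ∀ d, eval x (zpoly n q y d) = eval x (kpoly n q y d))
    (d : ℕ) : zpoly n q y d = kpoly n q y d := by
  induction d using Nat.strong_induction_on with
  | _ d ih =>
    rw [← sub_eq_zero]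
    refine eq_zero_of_qChain hn hq (fun i hi hin => ?_) ?_ (X_dvd_of_eval_eq_zero fun x hx => ?_)
    · rw [map_sub, rename_swap_zpoly hi hin, rename_swap_kpoly hi hin]
    · have := (qChain_zpoly hn hq y d).sub (qChain_kpoly hn hq y d)
      rw [← map_sub] at this
      convert this using 1
      split_ifs with hd
      · rw [ih (d - n) (by omega)]; ring
      · ring
    · rw [map_sub, h x hx d, sub_self]

theorem eval_zpoly_eq_eval_kpoly (n : ℕ) {q : ℂ} (hq : ∀ e, 1 ≤ e → q ^ e ≠ 1) (x y : ℕ → ℂ)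
    (d : ℕ) : eval x (zpoly n q y d) = eval x (kpoly n q y d) := by
  have zcomm : ∀ m (x y : ℕ → ℂ) d, eval x (zpoly m q y d) = eval y (zpoly m q x d) := by
    intro m x y d
    rw [eval_zpoly, eval_zpoly]
    exact Finset.sum_congr rfl fun p _ => by ring
  have kcomm : ∀ m (x y : ℕ → ℂ) d, eval x (kpoly m q y d) = eval y (kpoly m q x d) := by
    intro m x y d
    rw [eval_kpoly, eval_kpoly, kernelSeries_comm]
  induction n generalizing x y d with
  | zero =>
    have hk : kernelSeries 0 q x y = 1 := by simp [kernelSeries]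
    rw [eval_zpoly, eval_kpoly, hk, PowerSeries.coeff_one]
    split_ifs with hd
    · subst hd
      rw [Fintype.sum_unique]
      have : (default : Nat.Partition 0).parts = 0 := Nat.Partition.partition_zero_parts _
      rw [this]
      simp [mpoly, wpoly, wsum, bMult]
    · refine Finset.sum_eq_zero fun p _ => ?_
      obtain ⟨k, hk⟩ := Multiset.exists_mem_of_ne_zero fun h : p.parts = 0 =>
        hd (by simpa [h] using p.parts_sum.symm)
      rw [mpoly_eq_zero q hk (p.parts_pos hk), map_zero, map_zero, mul_zero]
  | succ n ih =>
    rw [zpoly_eq_kpoly_of_forall (by omega) hq fun x hx d => ?_]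
    rw [zcomm, kcomm, zpoly_eq_kpoly_of_forall (by omega) hq fun y hy d => ?_]
    rw [eval_zpoly, eval_kpoly, kernelSeries_succ q hy hx, ← eval_kpoly, ← ih, eval_zpoly]
    exact Finset.sum_congr rfl fun p _ => by rw [eval_mpoly_succ q hx, eval_mpoly_succ q hy]

end Kernel

section Convergence

open Filter Topology

lemma pow_ne_one_of_norm_lt {q : ℂ} (hq : ‖q‖ < 1) (e : ℕ) (he : 1 ≤ e) : q ^ e ≠ 1 := by
  intro h
  have h1 := congrArg norm h
  rw [norm_pow, norm_one] at h1
  exact (pow_lt_one₀ (norm_nonneg q) hq (by omega)).ne h1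

lemma summable_norm_euler {q t : ℂ} (hq : ‖q‖ < 1) (ht : ‖t‖ < 1) :
    Summable fun m => ‖(qPoch q m)⁻¹ * t ^ m‖ := by
  by_cases h0 : t = 0
  · refine summable_of_ne_finset_zero (s := {0}) fun m hm => ?_
    rw [h0, zero_pow (by simpa using hm)]; simp
  have hq' := pow_ne_one_of_norm_lt hq
  refine (summable_of_ratio_test_tendsto_lt_one ht (Eventually.of_forall fun m =>
    mul_ne_zero (inv_ne_zero (qPoch_ne_zero hq' m)) (pow_ne_zero m h0)) ?_).norm
  have h1 : ∀ m, ‖(qPoch q (m + 1))⁻¹ * t ^ (m + 1)‖ / ‖(qPoch q m)⁻¹ * t ^ m‖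
      = ‖t‖ / ‖1 - q ^ (m + 1)‖ := by
    intro m
    have h2 := norm_ne_zero_iff.2 (qPoch_ne_zero hq' m)
    have h3 := norm_ne_zero_iff.2 (sub_ne_zero.2 (hq' (m + 1) (by omega)).symm)
    have h4 := norm_ne_zero_iff.2 h0
    rw [qPoch_succ]
    simp only [norm_mul, norm_inv, norm_pow]
    field_simp
    exact pow_succ _ _
  simp only [h1]
  have h2 : Tendsto (fun m : ℕ => ‖1 - q ^ (m + 1)‖) atTop (𝓝 1) := by
    have := ((tendsto_pow_atTop_nhds_zero_of_norm_lt_one hq).comp (tendsto_add_atTop_nat 1))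
    simpa using (this.const_sub 1).norm
  have h3 := (tendsto_const_nhds (x := ‖t‖)).div h2 one_ne_zero
  rwa [div_one] at h3

lemma tsum_euler_functional {q t : ℂ} (hq : ‖q‖ < 1) (ht : ‖t‖ < 1) :
    ∑' m, (qPoch q m)⁻¹ * (q * t) ^ m = (1 - t) * ∑' m, (qPoch q m)⁻¹ * t ^ m := by
  have hq' := pow_ne_one_of_norm_lt hq
  have hs := (summable_norm_euler hq ht).of_norm
  have ht' : ‖q * t‖ < 1 := by
    rw [norm_mul]; exact mul_lt_one_of_nonneg_of_lt_one_left (norm_nonneg _) hq ht.le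
  have hs' := (summable_norm_euler hq ht').of_norm
  have h1 : ∑' m, (qPoch q m)⁻¹ * t ^ m - ∑' m, (qPoch q m)⁻¹ * (q * t) ^ m
      = t * ∑' m, (qPoch q m)⁻¹ * t ^ m := by
    rw [← hs.tsum_sub hs', (hs.sub hs').tsum_eq_zero_add, ← tsum_mul_left]
    simp only [pow_zero, sub_self, zero_add]
    refine tsum_congr fun m => ?_
    have h2 := qPoch_ne_zero hq' m
    have h3 := sub_ne_zero.2 (hq' (m + 1) (by omega)).symm
    rw [qPoch_succ]
    field_simp
    ring
  linear_combination -h1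

lemma tsum_euler {q t : ℂ} (hq : ‖q‖ < 1) (ht : ‖t‖ < 1) :
    ∑' m, (qPoch q m)⁻¹ * t ^ m = (qPochInf t q)⁻¹ := by
  have hN : ∀ N : ℕ, ∑' m, (qPoch q m)⁻¹ * (q ^ N * t) ^ m
      = (∏ k ∈ Finset.range N, (1 - q ^ k * t)) * ∑' m, (qPoch q m)⁻¹ * t ^ m := by
    intro N
    induction N with
    | zero => simp
    | succ N ih =>
      have : ‖q ^ N * t‖ < 1 := by
        rw [norm_mul, norm_pow]
        exact mul_lt_one_of_nonneg_of_lt_one_right (pow_le_one₀ (norm_nonneg _) hq.le)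
          (norm_nonneg _) ht
      rw [pow_succ', mul_assoc, tsum_euler_functional hq this, ih, Finset.prod_range_succ]
      ring
  have hL : Tendsto (fun N : ℕ => ∑' m, (qPoch q m)⁻¹ * (q ^ N * t) ^ m) atTop
      (𝓝 (∑' m, if m = 0 then (1 : ℂ) else 0)) := by
    refine tendsto_tsum_of_dominated_convergence (summable_norm_euler hq ht) (fun m => ?_)
      (Eventually.of_forall fun N m => ?_)
    · rcases Nat.eq_zero_or_pos m with rfl | hm
      · simp [qPoch_zero]
      · rw [if_neg (by omega)]
        have h1 := (tendsto_pow_atTop_nhds_zero_of_norm_lt_one hq).mul_const t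
        rw [zero_mul] at h1
        have h2 := (h1.pow m).const_mul (qPoch q m)⁻¹
        rwa [zero_pow (by omega), mul_zero] at h2
    · simp only [norm_mul, norm_pow]
      refine mul_le_mul_of_nonneg_left ?_ (norm_nonneg _)
      refine pow_le_pow_left₀ (by positivity) ?_ m
      exact mul_le_of_le_one_left (norm_nonneg _) (pow_le_one₀ (norm_nonneg _) hq.le)
  have hP : Tendsto (fun N => ∏ k ∈ Finset.range N, (1 - q ^ k * t)) atTop
      (𝓝 (qPochInf t q)) := by
    have hm : Multipliable fun k : ℕ => 1 + -(q ^ k * t) := by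
      refine multipliable_one_add_of_summable ?_
      simp only [norm_neg, norm_mul, norm_pow]
      exact (summable_geometric_of_lt_one (norm_nonneg q) hq).mul_right _
    simp only [← sub_eq_add_neg] at hm
    exact hm.hasProd.tendsto_prod_nat
  simp only [hN] at hL
  have h := tendsto_nhds_unique hL (hP.mul_const _)
  rw [tsum_ite_eq] at h
  exact eq_inv_of_mul_eq_one_right h.symm

/-- The series converges absolutely at `1` with sum `a`. -/
def HasAbsSum (f : PowerSeries ℂ) (a : ℂ) : Prop :=
  (Summable fun d => ‖PowerSeries.coeff d f‖) ∧ ∑' d, PowerSeries.coeff d f = a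

lemma hasAbsSum_eulerSeries {q t : ℂ} (hq : ‖q‖ < 1) (ht : ‖t‖ < 1) :
    HasAbsSum (eulerSeries q t) (qPochInf t q)⁻¹ := by
  have h : ∀ d, PowerSeries.coeff d (eulerSeries q t) = (qPoch q d)⁻¹ * t ^ d := fun d => by
    rw [eulerSeries, PowerSeries.coeff_mk, Algebra.algebraMap_self, RingHom.id_apply]
  rw [← tsum_euler hq ht, HasAbsSum]
  simp only [h]
  exact ⟨summable_norm_euler hq ht, trivial⟩

lemma HasAbsSum.mul {f g : PowerSeries ℂ} {a b : ℂ} (hf : HasAbsSum f a) (hg : HasAbsSum g b) :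
    HasAbsSum (f * g) (a * b) := by
  obtain ⟨hf, rfl⟩ := hf
  obtain ⟨hg, rfl⟩ := hg
  have h : ∀ d, PowerSeries.coeff d (f * g) = ∑ p ∈ Finset.HasAntidiagonal.antidiagonal d,
      PowerSeries.coeff p.1 f * PowerSeries.coeff p.2 g := fun d => PowerSeries.coeff_mul d f g
  rw [HasAbsSum]
  simp only [h]
  exact ⟨summable_norm_sum_mul_antidiagonal_of_summable_norm
      (f := fun d => PowerSeries.coeff d f) (g := fun d => PowerSeries.coeff d g) hf hg,
    (tsum_mul_tsum_eq_tsum_sum_antidiagonal_of_summable_norm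
      (f := fun d => PowerSeries.coeff d f) (g := fun d => PowerSeries.coeff d g) hf hg).symm⟩

lemma HasAbsSum.prod {ι : Type*} (s : Finset ι) {f : ι → PowerSeries ℂ} {a : ι → ℂ}
    (h : ∀ i ∈ s, HasAbsSum (f i) (a i)) : HasAbsSum (∏ i ∈ s, f i) (∏ i ∈ s, a i) := by
  classical
  induction s using Finset.induction_on with
  | empty =>
    refine ⟨summable_of_ne_finset_zero (s := {0}) fun m hm => ?_, ?_⟩
    · rw [Finset.prod_empty, PowerSeries.coeff_one, if_neg (by simpa using hm), norm_zero]
    · simp [PowerSeries.coeff_one]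
  | insert i s hi ih =>
    rw [Finset.prod_insert hi, Finset.prod_insert hi]
    exact (h i (Finset.mem_insert_self _ _)).mul
      (ih fun j hj => h j (Finset.mem_insert_of_mem hj))

lemma hasAbsSum_kernelSeries {n : ℕ} {q : ℂ} (hq : ‖q‖ < 1) {x y : ℕ → ℂ}
    (hxy : ∀ i ∈ Finset.Icc 1 n, ∀ j ∈ Finset.Icc 1 n, ‖x i * y j‖ < 1) :
    HasAbsSum (kernelSeries n q x y)
      (∏ i ∈ Finset.Icc 1 n, ∏ j ∈ Finset.Icc 1 n, (qPochInf (x i * y j) q)⁻¹) :=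
  HasAbsSum.prod _ fun i hi => HasAbsSum.prod _ fun j hj => hasAbsSum_eulerSeries hq (hxy i hi j hj)

/-- `w` is a nonnegative real number bounding the norm of `z`. -/
def DomBy (z w : ℂ) : Prop := ∃ r : ℝ, w = r ∧ ‖z‖ ≤ r

lemma DomBy.mul {z w z' w' : ℂ} (h : DomBy z w) (h' : DomBy z' w') : DomBy (z * z') (w * w') := by
  obtain ⟨r, rfl, hr⟩ := h
  obtain ⟨r', rfl, hr'⟩ := h'
  refine ⟨r * r', by simp, ?_⟩
  rw [norm_mul]
  exact mul_le_mul hr hr' (norm_nonneg _) ((norm_nonneg _).trans hr)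

lemma domBy_one : DomBy 1 1 := ⟨1, by simp⟩

lemma domBy_norm (z : ℂ) : DomBy z ‖z‖ := ⟨‖z‖, rfl, le_rfl⟩

lemma DomBy.pow {z w : ℂ} (h : DomBy z w) (m : ℕ) : DomBy (z ^ m) (w ^ m) := by
  induction m with
  | zero => simpa using domBy_one
  | succ m ih => rw [pow_succ, pow_succ]; exact ih.mul h

lemma DomBy.prod {ι : Type*} (s : Finset ι) {z w : ι → ℂ} (h : ∀ i ∈ s, DomBy (z i) (w i)) :
    DomBy (∏ i ∈ s, z i) (∏ i ∈ s, w i) := by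
  classical
  induction s using Finset.induction_on with
  | empty => simpa using domBy_one
  | insert i s hi ih =>
    rw [Finset.prod_insert hi, Finset.prod_insert hi]
    exact (h i (Finset.mem_insert_self _ _)).mul
      (ih fun j hj => h j (Finset.mem_insert_of_mem hj))

lemma DomBy.sum {ι : Type*} (s : Finset ι) {z w : ι → ℂ} (h : ∀ i ∈ s, DomBy (z i) (w i)) :
    DomBy (∑ i ∈ s, z i) (∑ i ∈ s, w i) := by
  choose! r h1 h2 using h
  refine ⟨∑ i ∈ s, r i, ?_, norm_sum_le_of_le s h2⟩
  rw [Complex.ofReal_sum]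
  exact Finset.sum_congr rfl h1

lemma domBy_qPoch_inv {q : ℂ} (hq : ‖q‖ < 1) (m : ℕ) :
    DomBy (qPoch q m)⁻¹ (qPoch ‖q‖ m)⁻¹ := by
  rw [qPoch, qPoch, ← Finset.prod_inv_distrib, ← Finset.prod_inv_distrib]
  refine DomBy.prod _ fun j _ => ⟨(1 - ‖q‖ ^ (j + 1))⁻¹, by simp, ?_⟩
  have h1 : ‖q‖ ^ (j + 1) < 1 := pow_lt_one₀ (norm_nonneg q) hq (by omega)
  rw [norm_inv]
  refine inv_anti₀ (by linarith) ?_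
  have := norm_sub_norm_le (1 : ℂ) (q ^ (j + 1))
  rwa [norm_one, norm_pow] at this

lemma domBy_eval_wsum (n : ℕ) (q : ℂ) (x : ℕ → ℂ) (hs : List ℕ) {φ ψ : List (Finset ℕ) → ℂ}
    (h : ∀ us, DomBy (φ us) (ψ us)) : DomBy (MvPolynomial.eval x (wsum n q hs φ))
      (MvPolynomial.eval (fun a => (‖x a‖ : ℂ)) (wsum n ‖q‖ hs ψ)) := by
  induction hs generalizing φ ψ with
  | nil => simpa [wsum] using h []
  | cons k hs ih =>
    simp only [wsum, map_sum, map_mul, map_prod, MvPolynomial.eval_X]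
    exact DomBy.sum _ fun c _ => (DomBy.prod _ fun a _ => domBy_norm _).mul
      (ih fun us => ((domBy_norm q).pow _).mul (h _))

lemma domBy_term {q : ℂ} (hq : ‖q‖ < 1) (n : ℕ) (x y : ℕ → ℂ) (s : Multiset ℕ) :
    DomBy (bMult q s * MvPolynomial.eval y (mpoly n q s) * MvPolynomial.eval x (mpoly n q s))
      (bMult ‖q‖ s * MvPolynomial.eval (fun a => (‖y a‖ : ℂ)) (mpoly n ‖q‖ s) *
        MvPolynomial.eval (fun a => (‖x a‖ : ℂ)) (mpoly n ‖q‖ s)) :=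
  ((DomBy.prod _ fun _ _ => domBy_qPoch_inv hq _).mul
    (domBy_eval_wsum n q y _ fun _ => domBy_one)).mul (domBy_eval_wsum n q x _ fun _ => domBy_one)

theorem tsum_partition {n : ℕ} {q : ℂ} (hq : ‖q‖ < 1) {x y : ℕ → ℂ}
    (hxy : ∀ i ∈ Finset.Icc 1 n, ∀ j ∈ Finset.Icc 1 n, ‖x i * y j‖ < 1) :
    ∑' p : (d : ℕ) × Nat.Partition d, bMult q p.2.parts *
        MvPolynomial.eval y (mpoly n q p.2.parts) * MvPolynomial.eval x (mpoly n q p.2.parts)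
      = ∏ i ∈ Finset.Icc 1 n, ∏ j ∈ Finset.Icc 1 n, (qPochInf (x i * y j) q)⁻¹ := by
  have hfib : ∀ {q : ℂ}, ‖q‖ < 1 → ∀ (x y : ℕ → ℂ) (d : ℕ), ∑ p : Nat.Partition d,
      bMult q p.parts * MvPolynomial.eval y (mpoly n q p.parts) *
        MvPolynomial.eval x (mpoly n q p.parts)
      = PowerSeries.coeff d (kernelSeries n q x y) := by
    intro q hq x y d
    rw [← eval_zpoly, eval_zpoly_eq_eval_kpoly n (pow_ne_one_of_norm_lt hq), eval_kpoly]
  have hsum : Summable fun p : (d : ℕ) × Nat.Partition d => bMult q p.2.parts *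
        MvPolynomial.eval y (mpoly n q p.2.parts) * MvPolynomial.eval x (mpoly n q p.2.parts) := by
    choose r hr1 hr2 using fun s => domBy_term hq n x y s
    have hr0 : ∀ s, 0 ≤ r s := fun s => (norm_nonneg _).trans (hr2 s)
    refine Summable.of_norm_bounded (g := fun p => r p.2.parts) ?_ fun p => hr2 _
    rw [summable_sigma_of_nonneg fun p => hr0 _]
    refine ⟨fun d => Summable.of_finite, ?_⟩
    have hq' : ‖(‖q‖ : ℂ)‖ < 1 := by simpa using hq
    have h := (hasAbsSum_kernelSeries (n := n) hq' (x := fun a => (‖x a‖ : ℂ))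
      (y := fun a => (‖y a‖ : ℂ)) (by simpa using hxy)).1
    refine h.congr fun d => ?_
    rw [← hfib hq', tsum_fintype, Finset.sum_congr rfl fun p _ => hr1 p.parts,
      ← Complex.ofReal_sum, Complex.norm_real, Real.norm_of_nonneg]
    exact Finset.sum_nonneg fun p _ => hr0 _
  rw [hsum.tsum_sigma' fun d => Summable.of_finite, ← (hasAbsSum_kernelSeries hq hxy).2]
  exact tsum_congr fun d => by rw [tsum_fintype, hfib hq]

end Convergence

/-- The carriers of a tableau given by its columns from right to left. -/
def carriers (n : ℕ) : List (Finset ℕ) → List (Finset ℕ)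
  | [] => []
  | c :: R => carry n c (carriers n R)

/-- The energy of a tableau given by its columns from right to left. -/
def revE (n : ℕ) : List (Finset ℕ) → ℕ
  | [] => 0
  | c :: R => carryE n c (carriers n R) + revE n R

lemma rowE_concat (n : ℕ) (x c : Finset ℕ) (ys : List (Finset ℕ)) :
    rowE n x (ys ++ [c]) = rowE n x ys + Hloc n (ys.foldl (Rright n) x) c := by
  induction ys generalizing x with
  | nil => simp [rowE]
  | cons y ys ih => simp [rowE, ih, add_assoc]

lemma carriers_concat (n : ℕ) (x : Finset ℕ) (R : List (Finset ℕ)) :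
    carriers n (R ++ [x]) = carriers n R ++ [R.reverse.foldl (Rright n) x] := by
  induction R with
  | nil => simp [carriers, carry]
  | cons c R ih => simp [carriers, carry, ih]

lemma revE_concat (n : ℕ) (x : Finset ℕ) (R : List (Finset ℕ)) :
    revE n (R ++ [x]) = revE n R + rowE n x R.reverse := by
  induction R with
  | nil => simp [revE, rowE, carryE, carriers]
  | cons c R ih =>
    rw [List.cons_append, revE, revE, ih, carriers_concat, List.reverse_cons, rowE_concat]
    simp only [carryE, List.map_append, List.sum_append, List.map_cons, List.map_nil,
      List.sum_cons, List.sum_nil]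
    omega

lemma intrinsicE_eq_revE (n : ℕ) (L : List (Finset ℕ)) : intrinsicE n L = revE n L.reverse := by
  induction L with
  | nil => simp [intrinsicE, revE]
  | cons x ys ih =>
    rw [intrinsicE, List.reverse_cons, revE_concat, List.reverse_reverse, ih, add_comm]

/-- The tableaux, as lists of columns from right to left, with given column heights. -/
def tabs (n : ℕ) : List ℕ → Finset (List (Finset ℕ))
  | [] => {[]}
  | h :: hs => ((Finset.Icc 1 n).powersetCard h).biUnion fun c => (tabs n hs).image (List.cons c)

lemma mem_tabs (n : ℕ) (hs : List ℕ) (R : List (Finset ℕ)) : R ∈ tabs n hs ↔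
    List.Forall₂ (fun h c => c ⊆ Finset.Icc 1 n ∧ c.card = h) hs R := by
  induction hs generalizing R with
  | nil => simp [tabs]
  | cons h hs ih =>
    rw [List.forall₂_cons_left_iff]
    simp only [tabs, Finset.mem_biUnion, Finset.mem_image, Finset.mem_powersetCard, ih]
    constructor
    · rintro ⟨c, hc, R', hR', rfl⟩
      exact ⟨c, R', hc, hR', rfl⟩
    · rintro ⟨c, R', hc, hR', rfl⟩
      exact ⟨c, hc, R', hR', rfl⟩

lemma eval_wsum (n : ℕ) (q : ℂ) (x : ℕ → ℂ) (hs : List ℕ) (φ : List (Finset ℕ) → ℂ) :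
    MvPolynomial.eval x (wsum n q hs φ) = ∑ R ∈ tabs n hs,
      q ^ revE n R * φ (carriers n R) * (R.map fun c => ∏ a ∈ c, x a).prod := by
  induction hs generalizing φ with
  | nil => simp [wsum, tabs, revE, carriers]
  | cons h hs ih =>
    rw [wsum, map_sum, tabs, Finset.sum_biUnion]
    · refine Finset.sum_congr rfl fun c _ => ?_
      rw [Finset.sum_image fun _ _ _ _ h => (List.cons.inj h).2, map_mul, map_prod, ih,
        Finset.mul_sum]
      refine Finset.sum_congr rfl fun R _ => ?_
      simp only [revE, carriers, MvPolynomial.eval_X, List.map_cons, List.prod_cons, pow_add]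
      ring
    · intro c _ c' _ hcc
      rw [Function.onFun, Finset.disjoint_left]
      intro R hR hR'
      obtain ⟨R1, -, rfl⟩ := Finset.mem_image.1 hR
      obtain ⟨R2, -, h2⟩ := Finset.mem_image.1 hR'
      exact hcc (List.cons.inj h2).1.symm

lemma prod_pow_cnt {n : ℕ} (x : ℕ → ℂ) {L : List (Finset ℕ)}
    (hL : ∀ c ∈ L, c ⊆ Finset.Icc 1 n) :
    ∏ a ∈ Finset.Icc 1 n, x a ^ cnt L a = (L.map fun c => ∏ a ∈ c, x a).prod := by
  induction L with
  | nil => simp [cnt]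
  | cons c L ih =>
    rw [List.map_cons, List.prod_cons, ← ih fun c hc => hL c (List.mem_cons_of_mem _ hc)]
    have h1 : ∀ a, cnt (c :: L) a = (if a ∈ c then 1 else 0) + cnt L a := fun a => by simp [cnt]
    simp only [h1, pow_add, Finset.prod_mul_distrib]
    congr 1
    rw [← Finset.prod_subset (hL c List.mem_cons_self)]
    · exact Finset.prod_congr rfl fun a ha => by simp [ha]
    · intro a _ ha
      simp [ha]

lemma lt_conj_iff (μ : YD) (r c : ℕ) : r < conj μ.val c ↔ c < μ.val r := by
  obtain ⟨f, hf, N, hN⟩ := μ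
  have hex : ∃ r, f r ≤ c := ⟨N, by omega⟩
  have hset : {r : ℕ | c + 1 ≤ f r} = Set.Iio (Nat.find hex) := by
    ext r
    rw [Set.mem_ofPred_eq, Set.mem_Iio, Nat.lt_find_iff]
    constructor
    · intro h m hm
      have := hf m r hm
      omega
    · intro h
      have := h r le_rfl
      omega
  have hc : conj f c = Nat.find hex := by
    rw [conj, hset]; simp
  have h := Set.ext_iff.1 hset r
  simp only [Set.mem_ofPred_eq, Set.mem_Iio] at h
  simp only [hc, ← h]
  omega

/-- The multiset of column heights of a partition. -/
noncomputable def cols (μ : YD) : Multiset ℕ := (Multiset.range (μ.val 0)).map (conj μ.val)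

lemma conj_antitone (μ : YD) {c c' : ℕ} (h : c ≤ c') : conj μ.val c' ≤ conj μ.val c := by
  by_contra! hlt
  have := (lt_conj_iff μ _ _).1 hlt
  have := (lt_conj_iff μ (conj μ.val c) c).2 (by omega)
  omega

lemma countP_cols (μ : YD) (r : ℕ) : (cols μ).countP (r < ·) = μ.val r := by
  rw [cols, Multiset.countP_map, ← Finset.range_val, ← Finset.filter_val, ← Finset.card_def]
  have : (Finset.range (μ.val 0)).filter (fun c => r < conj μ.val c)
      = Finset.range (μ.val r) := by
    ext c
    rw [Finset.mem_filter, lt_conj_iff, Finset.mem_range, Finset.mem_range]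
    have := μ.property.1 0 r (by omega)
    omega
  rw [this, Finset.card_range]

lemma pos_of_mem_cols {μ : YD} {k : ℕ} (hk : k ∈ cols μ) : 0 < k := by
  obtain ⟨c, hc, rfl⟩ := Multiset.mem_map.1 hk
  exact (lt_conj_iff μ 0 c).2 (Multiset.mem_range.1 hc)

lemma countP_lt_eq (s : Multiset ℕ) (r : ℕ) :
    s.countP (r < ·) = s.countP (r + 1 < ·) + s.count (r + 1) := by
  induction s using Multiset.induction_on with
  | empty => simp
  | cons a s ih =>
    rw [Multiset.countP_cons, Multiset.countP_cons, Multiset.count_cons, ih]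
    split_ifs <;> omega

lemma eq_of_countP_lt {s t : Multiset ℕ} (hs : 0 ∉ s) (ht : 0 ∉ t)
    (h : ∀ r, s.countP (r < ·) = t.countP (r < ·)) : s = t := by
  ext k
  cases k with
  | zero => rw [Multiset.count_eq_zero_of_notMem hs, Multiset.count_eq_zero_of_notMem ht]
  | succ k =>
    have h1 := countP_lt_eq s k
    have h2 := countP_lt_eq t k
    have h3 := h k
    have h4 := h (k + 1)
    omega

lemma bmu_eq_bMult (q : ℂ) (μ : YD) : bmu q μ.val = bMult q (cols μ) := by
  have hcount : ∀ i, μ.val i - μ.val (i + 1) = (cols μ).count (i + 1) := by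
    intro i
    rw [← countP_cols μ i, ← countP_cols μ (i + 1), countP_lt_eq]
    omega
  obtain ⟨N, hN⟩ := μ.property.2
  have hz : ∀ i, N ≤ i → μ.val i = 0 := fun i hi => by
    have := μ.property.1 N i hi
    omega
  rw [bMult_eq_prod q (S := (Finset.range N).map ⟨Nat.succ, Nat.succ_injective⟩),
    Finset.prod_map, bmu, finprod_eq_prod_of_mulSupport_subset (s := Finset.range N)]
  · simp only [hcount]; rfl
  · intro i hi
    rw [Function.mem_mulSupport] at hi
    rw [Finset.coe_range, Set.mem_Iio]
    by_contra! hcon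
    refine hi ?_
    rw [hz i hcon, Nat.zero_sub, qPoch_zero, inv_one]
  · intro k hk
    rw [Multiset.mem_toFinset] at hk
    have h0 := pos_of_mem_cols hk
    obtain ⟨c, hc, rfl⟩ := Multiset.mem_map.1 hk
    have h1 := (lt_conj_iff μ (conj μ.val c - 1) c).1 (by omega)
    rw [Finset.mem_map]
    refine ⟨conj μ.val c - 1, ?_, by simp; omega⟩
    rw [Finset.mem_range]
    by_contra! hcon
    have := hz _ hcon
    omega

lemma sort_cols (μ : YD) :
    (cols μ).sort (· ≤ ·) = ((List.range (μ.val 0)).map (conj μ.val)).reverse := by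
  refine List.Perm.eq_of_pairwise (le := (· ≤ ·)) (fun a b _ _ => le_antisymm)
    (Multiset.pairwise_sort _ _) ?_ ?_
  · rw [List.pairwise_reverse, List.pairwise_map]
    exact (List.pairwise_lt_range).imp fun h => conj_antitone μ h.le
  · rw [← Multiset.coe_eq_coe, Multiset.sort_eq, Multiset.coe_reverse]
    rfl

lemma isTableau_iff (n : ℕ) (μ : YD) (L : List (Finset ℕ)) :
    (L.length = μ.val 0 ∧ ∀ j : Fin L.length, (L.get j).card = conj μ.val (j : ℕ) ∧
      ∀ a ∈ L.get j, 1 ≤ a ∧ a ≤ n) ↔ L.reverse ∈ tabs n ((cols μ).sort (· ≤ ·)) := by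
  rw [mem_tabs, sort_cols, List.forall₂_reverse_iff, List.forall₂_iff_get]
  simp only [List.length_map, List.length_range, List.get_eq_getElem, List.getElem_map,
    List.getElem_range, Finset.subset_iff, Finset.mem_Icc]
  constructor
  · rintro ⟨h1, h2⟩
    exact ⟨h1.symm, fun i _ hi => ⟨fun a ha => (h2 ⟨i, hi⟩).2 a ha, (h2 ⟨i, hi⟩).1⟩⟩
  · rintro ⟨h1, h2⟩
    exact ⟨h1.symm, fun j => ⟨(h2 j (by omega) j.2).2, fun a ha => (h2 j (by omega) j.2).1 ha⟩⟩

lemma qWhit_eq_eval (n : ℕ) (x : ℕ → ℂ) (q : ℂ) (μ : YD) :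
    qWhit n x q μ.val = MvPolynomial.eval x (mpoly n q (cols μ)) := by
  rw [mpoly, wpoly, eval_wsum, ← Finset.tsum_subtype, qWhit]
  let e : VSTt n μ.val ≃ {R // R ∈ tabs n ((cols μ).sort (· ≤ ·))} :=
    (List.reverse_involutive.toPerm _).subtypeEquiv fun L => isTableau_iff n μ L
  rw [← e.tsum_eq]
  refine tsum_congr fun V => ?_
  have he : (e V : List (Finset ℕ)) = V.val.reverse := rfl
  rw [he, intrinsicE_eq_revE, mul_one, prod_pow_cnt x (L := V.val), List.map_reverse,
    List.prod_reverse]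
  intro c hc a ha
  obtain ⟨j, rfl⟩ := List.mem_iff_get.1 hc
  rw [Finset.mem_Icc]
  exact (V.property.2 j).2 a ha

/-- Partitions as sequences correspond to partitions as multisets of column heights. -/
noncomputable def toPartition (μ : YD) : (d : ℕ) × Nat.Partition d :=
  ⟨(cols μ).sum, cols μ, pos_of_mem_cols, rfl⟩

lemma sigma_partition_ext {a b : (d : ℕ) × Nat.Partition d} (h : a.2.parts = b.2.parts) :
    a = b := by
  obtain ⟨d, s, hs, rfl⟩ := a
  obtain ⟨d', s', hs', rfl⟩ := b
  simp only at h
  subst h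
  rfl

lemma toPartition_bijective : Function.Bijective toPartition := by
  constructor
  · intro μ ν h
    have h1 : cols μ = cols ν :=
      congrArg (fun p : (d : ℕ) × Nat.Partition d => p.2.parts) h
    ext r
    rw [← countP_cols μ, ← countP_cols ν, h1]
  · rintro ⟨d, p⟩
    let μ : YD := ⟨fun r => p.parts.countP (r < ·), fun i j hij => by
      beta_reduce
      rw [Multiset.countP_eq_card_filter, Multiset.countP_eq_card_filter]
      exact Multiset.card_le_card
        (Multiset.monotone_filter_right _ fun a ha => lt_of_le_of_lt hij ha), d, by
      rw [Multiset.countP_eq_zero]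
      exact fun a ha => not_lt.2 (p.le_of_mem_parts ha)⟩
    refine ⟨μ, sigma_partition_ext (eq_of_countP_lt (fun h => (pos_of_mem_cols h).ne rfl)
      (fun h => (p.parts_pos h).ne rfl) fun r => countP_cols μ r)⟩

/-- Cauchy identity for q-Whittaker polynomials:
`∑_μ b_μ(q) P_μ(x;q) P_μ(y;q) = ∏_{i,j=1}^n 1/(x_i y_j; q)_∞`. -/
theorem qWhittaker_Cauchy (n : ℕ) (q : ℂ) (hq : ‖q‖ < 1) (x y : ℕ → ℂ)
    (hxy : ∀ i ∈ Finset.Icc 1 n, ∀ j ∈ Finset.Icc 1 n, ‖x i * y j‖ < 1) :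
    ∑' μ : YD, bmu q μ.val * qWhit n x q μ.val * qWhit n y q μ.val
      = ∏ i ∈ Finset.Icc 1 n, ∏ j ∈ Finset.Icc 1 n, (qPochInf (x i * y j) q)⁻¹ := by
  rw [← tsum_partition hq hxy, ← (Equiv.ofBijective _ toPartition_bijective).tsum_eq]
  refine tsum_congr fun μ => ?_
  rw [bmu_eq_bMult, qWhit_eq_eval, qWhit_eq_eval, mul_right_comm]
  rfl
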